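/- arXiv:2006.01961 — 8 statements merged into one kernel-verified Lean document; each statement's English description precedes it below -/
import Mathlib

section
/- The number of Dyck paths of semi-length n in which the height of every peak is either equal to 1 or even (equivalently, no peak has odd height at least 3) equals the n-th Motzkin number M(n). -/
open Finset PowerSeries

/-- A word over the step alphabet (`true` = U = (1,1), `false` = D = (1,-1)) is a
Dyck path if it has equally many U's and D's and every prefix has at least as
many U's as D's (i.e. the lattice path never goes below the x-axis). -/
def IsDyck (w : List Bool) : Prop :=
  w.count true = w.count false ∧
    ∀ k, (w.take k).count false ≤ (w.take k).count true
/-- The height (y-coordinate) of the lattice point reached after the first `k` steps. -/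
def ht (w : List Bool) (k : ℕ) : ℕ :=
  (w.take k).count true - (w.take k).count false
/-- The word `w` has a peak (an occurrence of the factor `UD`) at position `i`;
the height of this peak is `ht w (i+1)`. -/
def IsPeakAt (w : List Bool) (i : ℕ) : Prop :=
  w[i]? = some true ∧ w[i + 1]? = some false

/-- Every peak (factor `true, false`) of the word `w`, started at height `h`, has a height
satisfying `P`. -/
def PeaksSatisfy (P : ℤ → Prop) : ℤ → List Bool → Prop
  | _, [] => True
  | h, true :: w => (w.head? = some false → P (h + 1)) ∧ PeaksSatisfy P (h + 1) w
  | h, false :: w => PeaksSatisfy P (h - 1) w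

theorem forall_isPeakAt_iff_peaksSatisfy (P : ℤ → Prop) (w : List Bool) (h : ℤ) :
    (∀ i, IsPeakAt w i →
      P (h + (w.take (i + 1)).count true - (w.take (i + 1)).count false)) ↔
      PeaksSatisfy P h w := by
  induction w generalizing h with
  | nil => simp [IsPeakAt, PeaksSatisfy]
  | cons b w ih =>
    cases b
    · rw [PeaksSatisfy, ← ih]
      constructor
      · intro H i hi
        have := H (i + 1) (by simpa [IsPeakAt] using hi)
        simp only [List.take_succ_cons, List.count_cons] at this ⊢
        convert this using 1
        simp
        ring
      · rintro H (_ | i) hi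
        · simp [IsPeakAt] at hi
        · have := H i (by simpa [IsPeakAt] using hi)
          rw [List.take_succ_cons, List.count_cons, List.count_cons]
          convert this using 1
          simp
          ring
    · rw [PeaksSatisfy, ← ih]
      constructor
      · intro H
        refine ⟨fun hw => ?_, fun i hi => ?_⟩
        · have := H 0 (by simpa [IsPeakAt, List.head?_eq_getElem?] using hw)
          simpa using this
        · have := H (i + 1) (by simpa [IsPeakAt] using hi)
          rw [List.take_succ_cons, List.count_cons, List.count_cons] at this
          convert this using 1
          simp
          ring
      · rintro ⟨H0, H⟩ (_ | i) hi
        · simpa using H0 (by simpa [IsPeakAt, List.head?_eq_getElem?] using hi)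
        · have := H i (by simpa [IsPeakAt] using hi)
          rw [List.take_succ_cons, List.count_cons, List.count_cons]
          convert this using 1
          simp
          ring

theorem peaksSatisfy_append_false_cons (P : ℤ → Prop) (v w : List Bool) (h : ℤ) :
    PeaksSatisfy P h (v ++ false :: w) ↔
      PeaksSatisfy P h v ∧
        (v.getLast? = some true → P (h + v.count true - v.count false)) ∧
        PeaksSatisfy P (h + v.count true - v.count false - 1) w := by
  induction v generalizing h with
  | nil => simp [PeaksSatisfy]
  | cons b v ih =>
    have key : ∀ x y : ℤ, h + 1 + x - y = h + (x + 1) - y := fun x y => by ring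
    have key' : ∀ x y : ℤ, h - 1 + x - y = h + x - (y + 1) := fun x y => by ring
    cases b
    · rw [List.cons_append, PeaksSatisfy, PeaksSatisfy, ih]
      simp [key', List.getLast?_cons]
      cases v.getLast? <;> simp
    · rw [List.cons_append, PeaksSatisfy, PeaksSatisfy, ih]
      cases v with
      | nil => simp [PeaksSatisfy]
      | cons c v =>
        simp only [List.count_cons_self, List.getLast?_cons_cons, Nat.cast_add, Nat.cast_one,
          List.count_cons_of_ne (show true ≠ false by simp), key, List.cons_append,
          List.head?_cons]
        tauto

open BinaryTree in
/-- The word of up steps (`true`) and down steps (`false`) encoded by a binary tree, through the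
first return decomposition. -/
def treeWord : BinaryTree Unit → List Bool
  | nil => []
  | node _ l r => true :: (treeWord l ++ false :: treeWord r)

theorem count_true_treeWord (t : BinaryTree Unit) : (treeWord t).count true = t.numNodes := by
  induction t with
  | nil => simp [treeWord]
  | node v l r hl hr => simp [treeWord, BinaryTree.numNodes, hl, hr]

theorem count_false_treeWord (t : BinaryTree Unit) : (treeWord t).count false = t.numNodes := by
  induction t with
  | nil => simp [treeWord]
  | node v l r hl hr => simp [treeWord, BinaryTree.numNodes, hl, hr]; ring

theorem getLast?_treeWord_ne (t : BinaryTree Unit) : (treeWord t).getLast? ≠ some true := by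
  induction t with
  | nil => simp [treeWord]
  | node v l r hl hr =>
    simp only [treeWord, List.getLast?_cons, List.getLast?_append] at hr ⊢
    cases h : (treeWord r).getLast? <;> simp_all

/-- The tree counterpart of `PeaksSatisfy`. -/
def TreePeaksSatisfy (P : ℤ → Prop) : ℤ → BinaryTree Unit → Prop
  | _, .nil => True
  | h, .node _ l r =>
    (l = .nil → P (h + 1)) ∧ TreePeaksSatisfy P (h + 1) l ∧ TreePeaksSatisfy P h r

theorem peaksSatisfy_treeWord (P : ℤ → Prop) (t : BinaryTree Unit) (h : ℤ) :
    PeaksSatisfy P h (treeWord t) ↔ TreePeaksSatisfy P h t := by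
  induction t generalizing h with
  | nil => simp [treeWord, PeaksSatisfy, TreePeaksSatisfy]
  | node v l r hl hr =>
    rw [treeWord, PeaksSatisfy, peaksSatisfy_append_false_cons, TreePeaksSatisfy, hl,
      count_true_treeWord, count_false_treeWord]
    have : (treeWord l ++ false :: treeWord r).head? = some false ↔ l = .nil := by
      cases l <;> simp [treeWord]
    rw [this, add_sub_cancel_right, add_sub_cancel_right, hr]
    simp [getLast?_treeWord_ne]

theorem treeWord_eq_map_ofTree (t : BinaryTree Unit) :
    treeWord t = (DyckWord.ofTree t).toList.map (fun s => decide (s = DyckStep.U)) := by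
  induction t with
  | nil => rfl
  | node v l r hl hr =>
    change _ = List.map _ (([DyckStep.U] ++ (DyckWord.ofTree l).toList ++ [DyckStep.D]) ++
      (DyckWord.ofTree r).toList)
    simp [treeWord, hl, hr]

theorem injective_decide_eq_U : Function.Injective (fun s => decide (s = DyckStep.U)) := by
  intro a b h
  cases a <;> cases b <;> simp_all

theorem treeWord_injective : Function.Injective treeWord := by
  intro s t h
  rw [treeWord_eq_map_ofTree, treeWord_eq_map_ofTree] at h
  exact DyckWord.equivTree.symm.injective
    (DyckWord.ext (List.map_injective_iff.2 injective_decide_eq_U h))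

theorem isDyck_treeWord (t : BinaryTree Unit) : IsDyck (treeWord t) := by
  refine ⟨by rw [count_true_treeWord, count_false_treeWord], fun k => ?_⟩
  rw [treeWord_eq_map_ofTree, ← List.map_take]
  have h := (DyckWord.ofTree t).count_D_le_count_U k
  rw [← List.count_map_of_injective _ _ injective_decide_eq_U,
    ← List.count_map_of_injective _ _ injective_decide_eq_U] at h
  simpa using h

theorem IsDyck.exists_treeWord_eq {w : List Bool} (hw : IsDyck w) : ∃ t, treeWord t = w := by
  let g : Bool → DyckStep := fun b => if b then .U else .D
  have hg : Function.Injective g := by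
    intro a b h
    cases a <;> cases b <;> simp_all [g]
  let p : DyckWord := ⟨w.map g,
    by
      have := hw.1
      rwa [← List.count_map_of_injective _ g hg, ← List.count_map_of_injective _ g hg] at this,
    fun i => by
      have := hw.2 i
      rwa [← List.count_map_of_injective _ g hg, ← List.count_map_of_injective _ g hg,
        List.map_take] at this⟩
  refine ⟨p.toTree, ?_⟩
  rw [treeWord_eq_map_ofTree, DyckWord.ofTree_toTree]
  change List.map _ (List.map g w) = w
  rw [List.map_map]
  convert List.map_id w
  ext b
  cases b <;> simp [g]

open Classical in
/-- The number of binary trees with `n` internal nodes satisfying `p`. -/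
noncomputable def treeCount (p : BinaryTree Unit → Prop) (n : ℕ) : ℕ :=
  #{t ∈ BinaryTree.treesOfNumNodesEq n | p t}

theorem treeCount_zero {p : BinaryTree Unit → Prop} (hp : p .nil) : treeCount p 0 = 1 := by
  simp [treeCount, filter_singleton, hp]

theorem BinaryTree.mem_pairwiseNode {a b : Finset (BinaryTree Unit)} {t : BinaryTree Unit} :
    t ∈ pairwiseNode a b ↔ ∃ l ∈ a, ∃ r ∈ b, t = node () l r := by
  rw [pairwiseNode, mem_map]
  constructor
  · rintro ⟨⟨l, r⟩, h, rfl⟩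
    rw [mem_product] at h
    exact ⟨l, h.1, r, h.2, rfl⟩
  · rintro ⟨l, hl, r, hr, rfl⟩
    exact ⟨(l, r), mem_product.2 ⟨hl, hr⟩, rfl⟩

theorem treeCount_succ {p q s : BinaryTree Unit → Prop}
    (hs : ∀ l r, s (.node () l r) ↔ p l ∧ q r) (n : ℕ) :
    treeCount s (n + 1) = ∑ ij ∈ antidiagonal n, treeCount p ij.1 * treeCount q ij.2 := by
  classical
  have : ({t ∈ BinaryTree.treesOfNumNodesEq (n + 1) | s t} : Finset _) =
      (antidiagonal n).biUnion fun ij => BinaryTree.pairwiseNode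
        {t ∈ BinaryTree.treesOfNumNodesEq ij.1 | p t}
        {t ∈ BinaryTree.treesOfNumNodesEq ij.2 | q t} := by
    ext t
    cases t with
    | nil => simp
    | node v l r =>
      simp only [BinaryTree.mem_pairwiseNode, BinaryTree.numNodes, hs, mem_filter, mem_biUnion,
        BinaryTree.mem_treesOfNumNodesEq, HasAntidiagonal.mem_antidiagonal, BinaryTree.node.injEq]
      constructor
      · rintro ⟨hn, hl, hr⟩
        exact ⟨(l.numNodes, r.numNodes), by simpa using hn, l, ⟨rfl, hl⟩, r, ⟨rfl, hr⟩,
          trivial, rfl, rfl⟩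
      · rintro ⟨ij, hij, l', ⟨hl, hpl⟩, r', ⟨hr, hqr⟩, -, rfl, rfl⟩
        exact ⟨by omega, hpl, hqr⟩
  rw [treeCount]
  convert congrArg Finset.card this
  rw [card_biUnion]
  · refine sum_congr rfl fun ij _ => ?_
    rw [BinaryTree.pairwiseNode, card_map, card_product, treeCount, treeCount]
  · rintro ⟨i, j⟩ - ⟨i', j'⟩ - hne
    refine disjoint_left.2 fun t ht ht' => ?_
    rw [BinaryTree.mem_pairwiseNode] at ht ht'
    obtain ⟨l, hl, r, hr, rfl⟩ := ht
    obtain ⟨l', hl', r', hr', heq⟩ := ht'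
    obtain ⟨-, rfl, rfl⟩ := BinaryTree.node.inj heq
    simp only [mem_filter, BinaryTree.mem_treesOfNumNodesEq] at hl hr hl' hr'
    exact hne (Prod.ext (hl.1.symm.trans hl'.1) (hr.1.symm.trans hr'.1))

theorem PowerSeries.mk_eq_one_add_X_mul {R : Type*} [CommSemiring R] {a b c : ℕ → R}
    (h0 : a 0 = 1)
    (h : ∀ n, a (n + 1) = ∑ ij ∈ antidiagonal n, b ij.1 * c ij.2) :
    PowerSeries.mk a = 1 + X * (PowerSeries.mk b * PowerSeries.mk c) := by
  ext n
  cases n with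
  | zero => simp [h0]
  | succ n =>
    rw [coeff_mk, h, map_add, coeff_succ_X_mul, coeff_mul, coeff_one]
    simp

/-- The condition on peak heights: equal to `1` or even. -/
def OneOrEven (z : ℤ) : Prop := z = 1 ∨ Even z

theorem treePeaksSatisfy_add_two (t : BinaryTree Unit) {h : ℤ} (hh : 1 ≤ h) :
    TreePeaksSatisfy OneOrEven (h + 2) t ↔ TreePeaksSatisfy OneOrEven h t := by
  induction t generalizing h with
  | nil => simp [TreePeaksSatisfy]
  | node v l r hl hr =>
    have hP : OneOrEven (h + 2 + 1) ↔ OneOrEven (h + 1) := by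
      simp only [OneOrEven, Int.even_iff]
      omega
    rw [TreePeaksSatisfy, TreePeaksSatisfy, hr hh, hP, add_right_comm, hl (by omega)]

/-- The number of trees with `n` internal nodes whose word, started at height `h`, has all its
peaks at height `1` or at even heights. -/
noncomputable def goodCount (h : ℤ) : ℕ → ℕ := treeCount (TreePeaksSatisfy OneOrEven h)

theorem goodCount_apply_zero (h : ℤ) : goodCount h 0 = 1 :=
  treeCount_zero (by simp [TreePeaksSatisfy])

theorem goodCount_succ_of_oneOrEven {h : ℤ} (hP : OneOrEven (h + 1)) (n : ℕ) :
    goodCount h (n + 1) =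
      ∑ ij ∈ antidiagonal n, goodCount (h + 1) ij.1 * goodCount h ij.2 :=
  treeCount_succ (fun l r => by simp [TreePeaksSatisfy, hP]) n

theorem goodCount_two_succ (n : ℕ) :
    goodCount 2 (n + 1) =
      ∑ ij ∈ antidiagonal n, (if ij.1 = 0 then 0 else goodCount 1 ij.1) * goodCount 2 ij.2 := by
  have h3 : ¬ OneOrEven (2 + 1) := by simp only [OneOrEven, Int.even_iff]; omega
  have hrec := treeCount_succ (p := fun t => t ≠ .nil ∧ TreePeaksSatisfy OneOrEven 1 t)
    (q := TreePeaksSatisfy OneOrEven 2) (s := TreePeaksSatisfy OneOrEven 2)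
    (fun l r => by
      rw [TreePeaksSatisfy, ← treePeaksSatisfy_add_two l le_rfl,
        show (1 : ℤ) + 2 = 2 + 1 by norm_num]
      tauto) n
  rw [goodCount, hrec]
  refine sum_congr rfl fun ij _ => ?_
  congr 1
  split_ifs with hi
  · simp [treeCount, hi, filter_singleton]
  · rw [goodCount, treeCount, treeCount]
    congr 1
    ext t
    simp only [mem_filter, BinaryTree.mem_treesOfNumNodesEq]
    constructor
    · tauto
    · rintro ⟨h, h'⟩
      refine ⟨h, ?_, h'⟩
      rintro rfl
      exact hi h.symm

theorem goodCount_one_succ (n : ℕ) : goodCount 1 (n + 1) = goodCount 0 n := by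
  let S (h : ℤ) : PowerSeries ℤ := PowerSeries.mk fun n => (goodCount h n : ℤ)
  have hF : S 0 = 1 + X * (S 1 * S 0) :=
    PowerSeries.mk_eq_one_add_X_mul (by simp [goodCount_apply_zero]) fun n => by
      rw [goodCount_succ_of_oneOrEven (by simp [OneOrEven])]
      simp
  have hO : S 1 = 1 + X * (S 2 * S 1) :=
    PowerSeries.mk_eq_one_add_X_mul (by simp [goodCount_apply_zero]) fun n => by
      rw [goodCount_succ_of_oneOrEven (by simp [OneOrEven])]
      simp
  have hO' : PowerSeries.mk (fun n => if n = 0 then 0 else (goodCount 1 n : ℤ)) = S 1 - 1 := by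
    ext n
    cases n <;> simp [S, goodCount_apply_zero, coeff_one]
  have hE : S 2 = 1 + X * ((S 1 - 1) * S 2) := by
    rw [← hO']
    exact PowerSeries.mk_eq_one_add_X_mul (by simp [goodCount_apply_zero]) fun n => by
      rw [goodCount_two_succ]
      simp
  -- Both `S 0` and `S 2 * S 1` are inverses of `1 - X * S 1`.
  have hEO : S 2 * S 1 * (1 - X * S 1) = 1 := by linear_combination S 1 * hE + hO
  have hFEO : S 0 = S 2 * S 1 := by
    linear_combination (S 2 * S 1) * hF - S 0 * hEO
  have hfinal : S 1 = 1 + X * S 0 := by rw [hFEO]; exact hO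
  have hcoeff := congrArg (coeff (n + 1)) hfinal
  simpa [S, coeff_succ_X_mul, coeff_one] using hcoeff

theorem goodCount_zero_succ (n : ℕ) :
    goodCount 0 (n + 1) = goodCount 0 n +
      ∑ k ∈ Finset.range n, goodCount 0 k * goodCount 0 (n - 1 - k) := by
  rw [goodCount_succ_of_oneOrEven (by simp [OneOrEven]), zero_add,
    Finset.Nat.sum_antidiagonal_eq_sum_range_succ (fun i j => goodCount 1 i * goodCount 0 j),
    sum_range_succ', add_comm]
  simp [goodCount_apply_zero, goodCount_one_succ, Nat.sub_sub, add_comm]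

theorem eq_of_motzkin_recurrence {M N : ℕ → ℕ} (h0 : M 0 = N 0)
    (hM : ∀ n, M (n + 1) = M n + ∑ k ∈ Finset.range n, M k * M (n - 1 - k))
    (hN : ∀ n, N (n + 1) = N n + ∑ k ∈ Finset.range n, N k * N (n - 1 - k)) (n : ℕ) :
    M n = N n := by
  induction n using Nat.strong_induction_on with
  | _ n ih =>
    cases n with
    | zero => exact h0
    | succ n =>
      rw [hM, hN, ih n (by omega)]
      congr 1
      refine sum_congr rfl fun k hk => ?_
      rw [mem_range] at hk
      rw [ih k (by omega), ih (n - 1 - k) (by omega)]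

theorem IsDyck.forall_isPeakAt_iff {w : List Bool} (hw : IsDyck w) :
    (∀ i, IsPeakAt w i → ht w (i + 1) = 1 ∨ Even (ht w (i + 1))) ↔
      PeaksSatisfy OneOrEven 0 w := by
  rw [← forall_isPeakAt_iff_peaksSatisfy]
  refine forall₂_congr fun i _ => ?_
  have h : 0 + ((w.take (i + 1)).count true : ℤ) - (w.take (i + 1)).count false =
      (ht w (i + 1) : ℕ) := by
    rw [ht, Nat.cast_sub (hw.2 _), zero_add]
  rw [h, OneOrEven, Int.even_coe_nat, Nat.cast_eq_one]

/-- The number of Dyck paths of semi-length `n` in which every peak height is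
either `1` or even equals the `n`-th Motzkin number, where the Motzkin numbers
are (uniquely) determined by `M 0 = 1` and
`M (n+1) = M n + ∑_{k=0}^{n-1} M k * M (n-1-k)`. -/
theorem statement0 (M : ℕ → ℕ) (hM0 : M 0 = 1)
    (hM : ∀ n, M (n + 1) = M n + ∑ k ∈ Finset.range n, M k * M (n - 1 - k))
    (n : ℕ) :
    Nat.card {w : List Bool // IsDyck w ∧ w.count true = n ∧
      ∀ i, IsPeakAt w i → ht w (i + 1) = 1 ∨ Even (ht w (i + 1))} = M n := by
  classical
  rw [eq_of_motzkin_recurrence (hM0.trans (goodCount_apply_zero 0).symm) hM goodCount_zero_succ n,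
    goodCount, treeCount, ← card_image_of_injective _ treeWord_injective]
  refine Nat.subtype_card _ fun w => ?_
  simp only [mem_image, mem_filter, BinaryTree.mem_treesOfNumNodesEq]
  constructor
  · rintro ⟨t, ⟨ht, hP⟩, rfl⟩
    refine ⟨isDyck_treeWord t, by rw [count_true_treeWord, ht], ?_⟩
    rwa [(isDyck_treeWord t).forall_isPeakAt_iff, peaksSatisfy_treeWord]
  · rintro ⟨hw, hn, hP⟩
    rw [hw.forall_isPeakAt_iff] at hP
    obtain ⟨t, rfl⟩ := hw.exists_treeWord_eq
    exact ⟨t, ⟨by rw [← hn, count_true_treeWord], (peaksSatisfy_treeWord _ _ _).1 hP⟩, rfl⟩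
end

section
/- Let a2(n) be the number of Dyck paths of semi-length n with no peak of even height, and let a3(n) be the number of Dyck paths of semi-length n with no peak of odd height. Then a3(0)=1 and, for every n >= 1, a3(n) = \sum_{i=1}^{n-1} a2(i) a3(n-1-i). -/
open Finset PowerSeries

/-- `EvenPeakPath e k w` says that `w`, started at height `k`, never goes below the x-axis, ends on
it, and that `h + e` is even for every peak height `h`. -/
def EvenPeakPath (e : ℕ) : ℕ → List Bool → Prop
  | k, [] => k = 0
  | k, true :: w => (w.head? = some false → Even (k + 1 + e)) ∧ EvenPeakPath e (k + 1) w
  | 0, false :: _ => False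
  | k + 1, false :: w => EvenPeakPath e k w

theorem evenPeakPath_iff (e k : ℕ) (w : List Bool) :
    EvenPeakPath e k w ↔ w.count true + k = w.count false ∧
      (∀ j, (w.take j).count false ≤ (w.take j).count true + k) ∧
      ∀ i, IsPeakAt w i →
        Even ((w.take (i + 1)).count true + k - (w.take (i + 1)).count false + e) := by
  induction w generalizing k with
  | nil => simp [EvenPeakPath, IsPeakAt]
  | cons b w ih =>
    cases b with
    | true =>
      rw [EvenPeakPath, ih]
      constructor
      · rintro ⟨h0, h1, h2, h3⟩
        refine ⟨by simp; omega, ?_, ?_⟩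
        · rintro (_ | j)
          · simp
          · have := h2 j
            simp; omega
        · rintro (_ | i) hi
          · have := h0 (by simpa [IsPeakAt, List.head?_eq_getElem?] using hi)
            simpa [add_comm, add_left_comm] using this
          · have := h3 i (by simpa [IsPeakAt] using hi)
            rw [List.take_succ_cons]
            simpa [add_assoc, add_comm 1 k] using this
      · rintro ⟨h1, h2, h3⟩
        refine ⟨fun h => ?_, by simp at h1; omega, fun j => ?_, fun i hi => ?_⟩
        · have := h3 0 (by simpa [IsPeakAt, List.head?_eq_getElem?] using h)
          simpa [add_comm, add_left_comm] using this
        · have := h2 (j + 1)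
          simp at this; omega
        · have := h3 (i + 1) (by simpa [IsPeakAt] using hi)
          rw [List.take_succ_cons] at this
          simpa [add_assoc, add_comm 1 k] using this
    | false =>
      cases k with
      | zero =>
        simp only [EvenPeakPath, false_iff]
        rintro ⟨-, h, -⟩
        simpa using h 1
      | succ k =>
        rw [EvenPeakPath, ih]
        constructor
        · rintro ⟨h1, h2, h3⟩
          refine ⟨by simp; omega, ?_, ?_⟩
          · rintro (_ | j)
            · simp
            · have := h2 j
              simp; omega
          · rintro (_ | i) hi
            · simp [IsPeakAt] at hi
            · have := h3 i (by simpa [IsPeakAt] using hi)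
              rw [List.take_succ_cons]
              simpa [← add_assoc, Nat.add_sub_add_right] using this
        · rintro ⟨h1, h2, h3⟩
          refine ⟨by simp at h1; omega, fun j => ?_, fun i hi => ?_⟩
          · have := h2 (j + 1)
            simp at this; omega
          · have := h3 (i + 1) (by simpa [IsPeakAt] using hi)
            rw [List.take_succ_cons] at this
            simpa [← add_assoc, Nat.add_sub_add_right] using this

theorem EvenPeakPath.count_true_add {e k : ℕ} {w : List Bool} (h : EvenPeakPath e k w) :
    w.count true + k = w.count false :=
  ((evenPeakPath_iff e k w).1 h).1

theorem EvenPeakPath.append_false_cons {e h k : ℕ} {p q : List Bool}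
    (hp : EvenPeakPath (e + h + 1) k p) (hq : EvenPeakPath e h q) :
    EvenPeakPath e (k + h + 1) (p ++ false :: q) := by
  induction p generalizing k with
  | nil =>
    obtain rfl : k = 0 := hp
    simpa [EvenPeakPath] using hq
  | cons b p ih =>
    cases b with
    | true =>
      obtain ⟨h0, hp⟩ := hp
      refine ⟨fun hd => ?_, by simpa [add_right_comm] using ih hp⟩
      cases p with
      | nil => simp [EvenPeakPath] at hp
      | cons c p =>
        have := h0 (by simpa using hd)
        convert this using 1
        omega
    | false =>
      cases k with
      | zero => exact hp.elim
      | succ k =>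
        have := ih (k := k) hp
        rw [show k + 1 + h + 1 = (k + h + 1) + 1 by omega]
        exact this

theorem EvenPeakPath.exists_append_false_cons {e h k : ℕ} {w : List Bool}
    (hw : EvenPeakPath e (k + h + 1) w) :
    ∃ p q, w = p ++ false :: q ∧ EvenPeakPath (e + h + 1) k p ∧ EvenPeakPath e h q := by
  induction w generalizing k with
  | nil => simp [EvenPeakPath] at hw
  | cons b w ih =>
    cases b with
    | true =>
      obtain ⟨h0, hw⟩ := hw
      obtain ⟨p, q, rfl, hp, hq⟩ :=
        ih (k := k + 1) (by rwa [show k + 1 + h + 1 = k + h + 1 + 1 by omega])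
      refine ⟨true :: p, q, rfl, ⟨fun hd => ?_, hp⟩, hq⟩
      cases p with
      | nil => simp at hd
      | cons c p =>
        have := h0 (by simpa using hd)
        convert this using 1
        omega
    | false =>
      cases k with
      | zero =>
        refine ⟨[], w, rfl, rfl, ?_⟩
        simpa [EvenPeakPath] using hw
      | succ k =>
        rw [show k + 1 + h + 1 = (k + h + 1) + 1 by omega] at hw
        obtain ⟨p, q, rfl, hp, hq⟩ := ih (k := k) hw
        exact ⟨false :: p, q, rfl, hp, hq⟩

theorem EvenPeakPath.append_false_cons_inj {e e' k : ℕ} {p p' q q' : List Bool}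
    (hp : EvenPeakPath e k p) (hp' : EvenPeakPath e' k p')
    (h : p ++ false :: q = p' ++ false :: q') : p = p' ∧ q = q' := by
  induction p generalizing k p' with
  | nil =>
    obtain rfl : k = 0 := hp
    rcases p' with _ | ⟨_ | _, p'⟩
    · simpa using h
    · exact hp'.elim
    · simp at h
  | cons b p ih =>
    rcases p' with _ | ⟨b', p'⟩
    · obtain rfl : k = 0 := hp'
      cases b
      · exact hp.elim
      · simp at h
    · simp only [List.cons_append, List.cons.injEq] at h
      obtain ⟨rfl, h⟩ := h
      suffices p = p' ∧ q = q' by simpa using this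
      cases b with
      | true => exact ih hp.2 hp'.2 h
      | false =>
        cases k with
        | zero => exact hp.elim
        | succ k => exact ih (k := k) hp hp' h

/-- The paths from the origin counted by `EvenPeakPath e 0`, of semi-length `n`. -/
abbrev EvenPeakDyck (e n : ℕ) : Type :=
  {w : List Bool // EvenPeakPath e 0 w ∧ w.count true = n}

instance (e n : ℕ) : Finite (EvenPeakDyck e n) := by
  refine Set.Finite.subset (List.finite_length_eq Bool (2 * n)) ?_
  rintro w ⟨hw, hn⟩
  have := hw.count_true_add
  have := List.count_true_add_count_false w
  simp only [Set.mem_ofPred_eq]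
  omega

theorem isDyck_and_iff_evenPeakPath (e : ℕ) (w : List Bool) :
    (IsDyck w ∧ ∀ i, IsPeakAt w i → Even (ht w (i + 1) + e)) ↔ EvenPeakPath e 0 w := by
  simp [evenPeakPath_iff, IsDyck, ht, and_assoc]

theorem card_evenPeakDyck_zero_zero : Nat.card (EvenPeakDyck 0 0) = 1 := by
  rw [Nat.card_eq_one_iff_exists]
  refine ⟨⟨[], rfl, rfl⟩, ?_⟩
  rintro ⟨w, hw, hn⟩
  have := hw.count_true_add
  have := List.count_true_add_count_false w
  exact Subtype.ext (List.length_eq_zero_iff.1 (by simp only; omega))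

/-- The path `U p D q` has no peak of odd height when `p` is a nonempty Dyck path with no peak of
even height and `q` is a Dyck path with no peak of odd height. -/
def joinFirstReturn {n : ℕ} (hn : 1 ≤ n)
    (x : Σ i : Finset.Icc 1 (n - 1), EvenPeakDyck 1 i × EvenPeakDyck 0 (n - 1 - i)) :
    EvenPeakDyck 0 n :=
  ⟨true :: (x.2.1.1 ++ false :: x.2.2.1), by
    obtain ⟨⟨i, hi⟩, ⟨p, hp, hpi⟩, q, hq, hqi⟩ := x
    simp only [Finset.mem_Icc] at hi hpi hqi
    refine ⟨⟨fun hd => ?_, by simpa using hp.append_false_cons (e := 0) (h := 0) hq⟩, ?_⟩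
    · rcases p with _ | ⟨_ | _, p⟩
      · simp at hpi; omega
      · exact hp.elim
      · simp at hd
    · simp; omega⟩

theorem joinFirstReturn_bijective {n : ℕ} (hn : 1 ≤ n) :
    Function.Bijective (joinFirstReturn hn) := by
  constructor
  · rintro ⟨⟨i, hi⟩, ⟨p, hp, hpi⟩, q, hq, hqi⟩ ⟨⟨i', hi'⟩, ⟨p', hp', hpi'⟩, q', hq', hqi'⟩ h
    have h : p ++ false :: q = p' ++ false :: q' := by
      simpa [joinFirstReturn] using h
    obtain ⟨rfl, rfl⟩ := hp.append_false_cons_inj hp' h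
    obtain rfl : i = i' := hpi.symm.trans hpi'
    rfl
  · rintro ⟨w, hw, hwn⟩
    rcases w with _ | ⟨_ | _, w⟩
    · simp at hwn; omega
    · exact hw.elim
    · obtain ⟨h0, hw⟩ := hw
      obtain ⟨p, q, rfl, hp, hq⟩ := EvenPeakPath.exists_append_false_cons (h := 0) (k := 0) hw
      have hpos : 0 < p.count true := by
        have := hp.count_true_add
        have := List.count_true_add_count_false p
        rcases p with _ | ⟨b, p⟩
        · simp at h0
        · simp only [List.length_cons] at this
          omega
      simp at hwn
      exact ⟨⟨⟨p.count true, by simp only [Finset.mem_Icc]; omega⟩, ⟨p, hp, rfl⟩,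
        ⟨q, hq, by simp only; omega⟩⟩, rfl⟩

theorem card_evenPeakDyck_zero {n : ℕ} (hn : 1 ≤ n) :
    Nat.card (EvenPeakDyck 0 n) = ∑ i ∈ Finset.Icc 1 (n - 1),
      Nat.card (EvenPeakDyck 1 i) * Nat.card (EvenPeakDyck 0 (n - 1 - i)) := by
  rw [← Nat.card_eq_of_bijective _ (joinFirstReturn_bijective hn), Nat.card_sigma]
  simp only [Nat.card_prod]
  exact Finset.sum_coe_sort (Finset.Icc 1 (n - 1)) fun i =>
    Nat.card (EvenPeakDyck 1 i) * Nat.card (EvenPeakDyck 0 (n - 1 - i))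

/-- Let `a2 n` count Dyck paths of semi-length `n` with no peak of even height,
and `a3 n` count Dyck paths of semi-length `n` with no peak of odd height.
Then `a3 0 = 1` and for `n ≥ 1`, `a3 n = ∑_{i=1}^{n-1} a2 i * a3 (n-1-i)`. -/
theorem statement4 (a2 a3 : ℕ → ℕ)
    (ha2 : ∀ n, a2 n = Nat.card {w : List Bool // IsDyck w ∧ w.count true = n ∧
      ∀ i, IsPeakAt w i → ¬ Even (ht w (i + 1))})
    (ha3 : ∀ n, a3 n = Nat.card {w : List Bool // IsDyck w ∧ w.count true = n ∧
      ∀ i, IsPeakAt w i → ¬ Odd (ht w (i + 1))}) :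
    a3 0 = 1 ∧ ∀ n, 1 ≤ n →
      a3 n = ∑ i ∈ Finset.Icc 1 (n - 1), a2 i * a3 (n - 1 - i) := by
  have h2 : ∀ n, a2 n = Nat.card (EvenPeakDyck 1 n) := fun n => by
    rw [ha2]
    refine Nat.card_congr (Equiv.subtypeEquivRight fun w => ?_)
    rw [← isDyck_and_iff_evenPeakPath]
    simp only [Nat.even_add_one]
    tauto
  have h3 : ∀ n, a3 n = Nat.card (EvenPeakDyck 0 n) := fun n => by
    rw [ha3]
    refine Nat.card_congr (Equiv.subtypeEquivRight fun w => ?_)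
    rw [← isDyck_and_iff_evenPeakPath]
    simp only [Nat.not_odd_iff_even, add_zero]
    tauto
  simp only [h2, h3]
  exact ⟨card_evenPeakDyck_zero_zero, fun n hn => card_evenPeakDyck_zero hn⟩
end

section
/- Let f1, f2, f3 be formal power series over the rationals satisfying the system f1 = 1 + x f2 f1, f2 = 1 + x f3 f2, and f3 = 1 + x (f2 - 1) f3. Then f1 = 1 + x f1 + x^2 f1^2. -/
open PowerSeries

/-- If formal power series `f1, f2, f3` over `ℚ` satisfy the system
`f1 = 1 + x f2 f1`, `f2 = 1 + x f3 f2`, `f3 = 1 + x (f2 - 1) f3`,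
then `f1 = 1 + x f1 + x² f1²`. -/
theorem statement5 (f1 f2 f3 : PowerSeries ℚ)
    (h1 : f1 = 1 + PowerSeries.X * f2 * f1)
    (h2 : f2 = 1 + PowerSeries.X * f3 * f2)
    (h3 : f3 = 1 + PowerSeries.X * (f2 - 1) * f3) :
    f1 = 1 + PowerSeries.X * f1 + PowerSeries.X ^ 2 * f1 ^ 2 := by
  have key : (f2 - 1) * (1 - X * f2) = X := by
    linear_combination (1 + X - X * f2) * h2 + X * f2 * h3
  have h : f2 = 1 + X * f1 := by
    linear_combination f1 * key - (f2 - 1) * h1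
  linear_combination h1 + X * f1 * h
end

section
/- Let a(n) be the number of Dyck paths of semi-length n such that no peak has height 1, no maximal ascending run has length 2, and no maximal descending run has length 1, and let f = \sum_{n\ge 0} a(n) x^n in the ring of formal power series over the integers. Then 1 + (-x^2 - x - 1) f + (x^4 + x^3 + x^2 + x) f^2 = 0. -/
open Finset PowerSeries

/-- The word `w` has a maximal ascending run (maximal block of consecutive U-steps)
starting at position `i` and of length `l`. -/
def AscRun (w : List Bool) (i l : ℕ) : Prop :=
  1 ≤ l ∧ (∀ j < l, w[i + j]? = some true) ∧
    (∀ i', i = i' + 1 → w[i']? = some false) ∧ w[i + l]? ≠ some true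

/-- The word `w` has a maximal descending run (maximal block of consecutive D-steps)
starting at position `i` and of length `l`. -/
def DescRun (w : List Bool) (i l : ℕ) : Prop :=
  1 ≤ l ∧ (∀ j < l, w[i + j]? = some false) ∧
    (∀ i', i = i' + 1 → w[i']? = some true) ∧ w[i + l]? ≠ some false

namespace DyckRuns

/-- States of the automaton that reads a path and detects ascending runs of length `2` and
descending runs of length `1`: `u1`, `u2`, `u3` record an ascending run of length `1`, `2` or at
least `3`, `d1` and `d2` a descending run of length `1` or at least `2` (or the empty path), and
`dead` that a forbidden run has been completed. -/
inductive RunState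
  | u1 | u2 | u3 | d1 | d2 | dead
  deriving DecidableEq

open RunState BinaryTree

/-- The transition function of the automaton. -/
def step : RunState → Bool → RunState
  | u1, true => u2
  | u1, false => d1
  | u2, true => u3
  | u2, false => dead
  | u3, true => u3
  | u3, false => d1
  | d1, true => dead
  | d1, false => d2
  | d2, true => u1
  | d2, false => d2
  | dead, _ => dead

theorem step_dead (b : Bool) : step dead b = dead := by cases b <;> rfl

/-! ### The automaton recognizes the forbidden runs -/

/-- What the state reached after `k` steps says about the word `w` around position `k`. -/
def StateSpec (w : List Bool) (k : ℕ) : RunState → Prop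
  | u1 => ∃ j, k = j + 1 ∧ w[j]? = some true ∧ ∀ i, j = i + 1 → w[i]? = some false
  | u2 => ∃ j, k = j + 2 ∧ w[j]? = some true ∧ w[j + 1]? = some true ∧
      ∀ i, j = i + 1 → w[i]? = some false
  | u3 => ∃ j, k = j + 1 ∧ w[j]? = some true
  | d1 => ∃ j, k = j + 2 ∧ w[j]? = some true ∧ w[j + 1]? = some false
  | d2 => ∀ i, k = i + 1 → w[i]? = some false
  | dead => (∃ i, AscRun w i 2) ∨ ∃ i, DescRun w i 1

/-- The state reached after the first `k` steps. -/
def stateAt (w : List Bool) (k : ℕ) : RunState := (w.take k).foldl step d2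

theorem stateAt_succ {w : List Bool} {k : ℕ} {b : Bool} (h : w[k]? = some b) :
    stateAt w (k + 1) = step (stateAt w k) b := by
  simp [stateAt, List.take_add_one, h]

theorem stateAt_dead_of_le {w : List Bool} {k m : ℕ} (hkm : k ≤ m) (h : stateAt w k = dead) :
    stateAt w m = dead := by
  induction m, hkm using Nat.le_induction with
  | base => exact h
  | succ m _ ih =>
    cases hb : w[m]? with
    | none => simpa [stateAt, List.take_add_one, hb] using ih
    | some b => rw [stateAt_succ hb, ih, step_dead]

theorem stateSpec_step {w : List Bool} {k : ℕ} {s : RunState} {b : Bool}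
    (hs : StateSpec w k s) (hb : w[k]? = some b) : StateSpec w (k + 1) (step s b) := by
  cases s <;> cases b <;> simp only [step, StateSpec] at hs ⊢
  case u1.false =>
    obtain ⟨j, rfl, h, -⟩ := hs
    exact ⟨j, rfl, h, hb⟩
  case u1.true =>
    obtain ⟨j, rfl, h⟩ := hs
    exact ⟨j, rfl, h.1, hb, h.2⟩
  case u2.false =>
    obtain ⟨j, rfl, h0, h1, h2⟩ := hs
    refine Or.inl ⟨j, by norm_num, fun i hi => ?_, h2, by simp [hb]⟩
    interval_cases i <;> assumption
  case d1.true =>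
    obtain ⟨j, rfl, h0, h1⟩ := hs
    refine Or.inr ⟨j + 1, le_rfl, fun i hi => ?_, fun i hi => ?_, by simp [hb]⟩
    · interval_cases i; exact h1
    · obtain rfl : j = i := by omega
      exact h0
  case u3.false =>
    obtain ⟨j, rfl, h⟩ := hs
    exact ⟨j, rfl, h, hb⟩
  all_goals grind

theorem stateSpec_stateAt (w : List Bool) (k : ℕ) :
    StateSpec w (min k w.length) (stateAt w k) := by
  induction k with
  | zero => simp [stateAt, StateSpec]
  | succ k ih =>
    rcases lt_or_ge k w.length with hk | hk
    · rw [min_eq_left hk.le] at ih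
      rw [min_eq_left hk, stateAt_succ (List.getElem?_eq_getElem hk)]
      exact stateSpec_step ih (List.getElem?_eq_getElem hk)
    · rw [min_eq_right hk] at ih
      rw [min_eq_right (by omega)]
      simpa [stateAt, List.take_of_length_le, hk, Nat.le_succ_of_le hk] using ih

theorem foldl_step_eq_d2_iff {w : List Bool} (hw : w[0]? ≠ some false)
    (hlast : ∀ i, w.length = i + 1 → w[i]? ≠ some true) :
    w.foldl step d2 = d2 ↔
      (∀ i l, AscRun w i l → l ≠ 2) ∧ ∀ i l, DescRun w i l → l ≠ 1 := by
  have hfin : w.foldl step d2 = stateAt w w.length := by simp [stateAt]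
  have hspec (k : ℕ) (hk : k ≤ w.length) : StateSpec w k (stateAt w k) := by
    simpa [hk] using stateSpec_stateAt w k
  constructor
  · intro h
    rw [hfin] at h
    have hnd (k : ℕ) (hk : k ≤ w.length) : stateAt w k ≠ dead := fun hd => by
      rw [stateAt_dead_of_le hk hd] at h
      cases h
    refine ⟨?_, ?_⟩
    · rintro i l ⟨-, hrun, hpre, hpost⟩ rfl
      have h0 : w[i]? = some true := hrun 0 (by norm_num)
      have h1 : w[i + 1]? = some true := hrun 1 (by norm_num)
      have hlen : i + 1 < w.length := (List.getElem?_eq_some_iff.1 h1).1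
      have e1 := stateAt_succ h0
      have e2 := stateAt_succ h1
      have n1 := hnd (i + 1) (by omega)
      have n2 := hnd (i + 2) (by omega)
      have hs := hspec i (by omega)
      have : stateAt w i = d2 := by
        cases hi : stateAt w i <;> rw [hi] at hs e1 <;> simp only [StateSpec, step] at hs e1
        case u1 =>
          obtain ⟨j, rfl, h3, -⟩ := hs
          simp [hpre j rfl] at h3
        case u2 =>
          obtain ⟨j, rfl, -, h3, -⟩ := hs
          simp [hpre (j + 1) rfl] at h3
        case u3 =>
          obtain ⟨j, rfl, h3⟩ := hs
          simp [hpre j rfl] at h3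
        case d1 => exact absurd e1 n1
        case dead => exact absurd e1 n1
      rw [this] at e1
      rw [e1] at e2
      cases h2 : w[i + 2]? with
      | none =>
        have : w.length = i + 2 := by
          have := List.getElem?_eq_none_iff.1 h2
          omega
        exact hlast _ this h1
      | some b =>
        cases b with
        | true => exact hpost h2
        | false =>
          have hlen := (List.getElem?_eq_some_iff.1 h2).1
          apply hnd (i + 3) (by omega)
          rw [stateAt_succ h2, e2]
          rfl
    · rintro i l ⟨-, hrun, hpre, hpost⟩ rfl
      have h0 : w[i]? = some false := hrun 0 (by norm_num)
      have hlen : i < w.length := (List.getElem?_eq_some_iff.1 h0).1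
      obtain _ | i := i
      · exact hw h0
      have hp := hpre i rfl
      have e1 := stateAt_succ h0
      have n1 := hnd (i + 2) (by omega)
      have hs := hspec (i + 1) (by omega)
      have : stateAt w (i + 2) = d1 := by
        cases hi : stateAt w (i + 1) <;> rw [hi] at hs e1 <;> simp only [StateSpec, step] at hs e1
        case u1 => exact e1
        case u2 => exact absurd e1 n1
        case u3 => exact e1
        case d1 =>
          obtain ⟨j, hj, -, h3⟩ := hs
          obtain rfl : i = j + 1 := by omega
          simp [hp] at h3
        case d2 => simp [hs i rfl] at hp
        case dead => exact absurd e1 n1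
      cases h1 : w[i + 2]? with
      | none =>
        have hl : w.length = i + 2 := by
          have := List.getElem?_eq_none_iff.1 h1
          omega
        rw [hl, this] at h
        cases h
      | some b =>
        cases b with
        | false => exact hpost h1
        | true =>
          have hlen := (List.getElem?_eq_some_iff.1 h1).1
          apply hnd (i + 3) (by omega)
          rw [stateAt_succ h1, this]
          rfl
  · rintro ⟨hasc, hdesc⟩
    rw [hfin]
    have hs := hspec _ le_rfl
    cases hi : stateAt w w.length <;> rw [hi] at hs <;> simp only [StateSpec] at hs
    case d1 =>
      obtain ⟨j, hj, h0, h1⟩ := hs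
      refine absurd rfl (hdesc (j + 1) 1 ⟨le_rfl, fun i hi => ?_, fun i hi => ?_, by simp [← hj]⟩)
      · interval_cases i; exact h1
      · obtain rfl : j = i := by omega
        exact h0
    case dead =>
      rcases hs with ⟨i, hi⟩ | ⟨i, hi⟩
      · exact absurd rfl (hasc _ _ hi)
      · exact absurd rfl (hdesc _ _ hi)
    all_goals grind

/-! ### Dyck paths -/

theorem head_ne_false_of_isDyck {w : List Bool} (h : IsDyck w) : w[0]? ≠ some false := by
  intro h0
  have := h.2 1
  simp [List.take_add_one, h0] at this

theorem getLast_ne_true_of_isDyck {w : List Bool} (h : IsDyck w) (i : ℕ) (hi : w.length = i + 1) :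
    w[i]? ≠ some true := by
  intro h0
  have h1 := h.2 i
  have h2 := h.1
  have h3 : w = w.take i ++ [true] := by
    conv_lhs => rw [← List.take_length (l := w), hi, List.take_add_one, h0]
    rfl
  rw [h3] at h2
  simp at h2
  omega

/-- After a peak of height `1` the path descends by exactly one step, so a path without
descending runs of length `1` has no such peak. -/
theorem peak_height_ne_one_of_isDyck {w : List Bool} (h : IsDyck w)
    (hdesc : ∀ i l, DescRun w i l → l ≠ 1) (i : ℕ) (hi : IsPeakAt w i) : ht w (i + 1) ≠ 1 := by
  intro hh
  obtain ⟨h0, h1⟩ := hi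
  refine hdesc (i + 1) 1 ⟨le_rfl, fun j hj => ?_, fun j hj => ?_, fun h2 => ?_⟩ rfl
  · interval_cases j; exact h1
  · obtain rfl : i = j := by omega
    exact h0
  · have := h.2 (i + 3)
    simp only [ht] at hh
    simp [List.take_add_one (i := i + 2), List.take_add_one (i := i + 1), h1, h2] at this
    omega

/-- The equivalence between the two step alphabets. -/
def stepEquiv : DyckStep ≃ Bool where
  toFun s := decide (s = .U)
  invFun b := if b then .U else .D
  left_inv s := by cases s <;> rfl
  right_inv b := by cases b <;> rfl

theorem count_map_stepEquiv (l : List DyckStep) :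
    (l.map stepEquiv).count true = l.count .U ∧ (l.map stepEquiv).count false = l.count .D :=
  ⟨List.count_map_of_injective l stepEquiv stepEquiv.injective .U,
    List.count_map_of_injective l stepEquiv stepEquiv.injective .D⟩

theorem isDyck_map_stepEquiv (l : List DyckStep) :
    IsDyck (l.map stepEquiv) ↔
      l.count .U = l.count .D ∧ ∀ k, (l.take k).count .D ≤ (l.take k).count .U := by
  simp only [IsDyck, ← List.map_take, count_map_stepEquiv]

/-- Binary trees correspond to Dyck paths. -/
def treeEquiv : BinaryTree Unit ≃ {w : List Bool // IsDyck w} where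
  toFun t := ⟨(DyckWord.ofTree t).toList.map stepEquiv,
    (isDyck_map_stepEquiv _).2 ⟨DyckWord.count_U_eq_count_D _, DyckWord.count_D_le_count_U _⟩⟩
  invFun w := DyckWord.toTree ⟨w.1.map stepEquiv.symm,
    ((isDyck_map_stepEquiv _).1 (by simpa using w.2)).1,
    ((isDyck_map_stepEquiv _).1 (by simpa using w.2)).2⟩
  left_inv t := (congrArg DyckWord.toTree (DyckWord.ext (by simp))).trans
    (DyckWord.toTree_ofTree t)
  right_inv w := by simp [DyckWord.ofTree_toTree]

/-- The Dyck path of a binary tree. -/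
def word (t : BinaryTree Unit) : List Bool := (treeEquiv t).1

theorem word_nil : word nil = [] := rfl

theorem word_node (a : Unit) (l r : BinaryTree Unit) :
    word (node a l r) = true :: (word l ++ false :: word r) := by
  change List.map stepEquiv ((([DyckStep.U] ++ (DyckWord.ofTree l).toList) ++ [DyckStep.D]) ++
    (DyckWord.ofTree r).toList) = _
  simp [word, treeEquiv, stepEquiv]

theorem count_true_word (t : BinaryTree Unit) : (word t).count true = t.numNodes := by
  induction t with
  | nil => rfl
  | node a l r ihl ihr => simp [word_node, BinaryTree.numNodes, ihl, ihr, add_assoc]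

/-! ### The automaton on binary trees -/

/-- The state reached from `s` by reading the Dyck path of `t`. -/
def run (s : RunState) (t : BinaryTree Unit) : RunState := (word t).foldl step s

theorem run_nil (s : RunState) : run s nil = s := rfl

theorem run_node (s : RunState) (a : Unit) (l r : BinaryTree Unit) :
    run s (node a l r) = run (step (run (step s true) l) false) r := by
  simp [run, word_node]

theorem run_dead (t : BinaryTree Unit) : run dead t = dead := by
  induction t with
  | nil => rfl
  | node a l r ihl ihr => rw [run_node, step_dead, ihl, step_dead, ihr]

theorem run_d1_of_ne_nil {t : BinaryTree Unit} (ht : t ≠ nil) : run d1 t = dead := by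
  cases t with
  | nil => exact absurd rfl ht
  | node a l r => simp [run_node, step, run_dead]

theorem run_u3_of_ne_nil {t : BinaryTree Unit} (ht : t ≠ nil) : run u3 t = run u2 t := by
  cases t with
  | nil => exact absurd rfl ht
  | node a l r => simp [run_node, step]

theorem run_of_ne_nil {t : BinaryTree Unit} (ht : t ≠ nil) (s : RunState) :
    run s t = d1 ∨ run s t = d2 ∨ run s t = dead := by
  induction t generalizing s with
  | nil => exact absurd rfl ht
  | node a l r ihl ihr =>
    rw [run_node]
    by_cases hr : r = nil
    · rw [hr, run_nil]
      cases run (step s true) l <;> simp [step]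
    · exact ihr hr _

theorem step_run_false {t : BinaryTree Unit} (ht : t ≠ nil) (s : RunState) :
    step (run s t) false = if run s t = dead then dead else d2 := by
  rcases run_of_ne_nil ht s with h | h | h <;> simp [h, step]

theorem run_d2_node_eq_d2_iff (l r : BinaryTree Unit) :
    run d2 (node () l r) = d2 ↔ (l ≠ nil ∧ run u1 l ≠ dead) ∧ run d2 r = d2 := by
  rw [run_node]
  by_cases hl : l = nil
  · by_cases hr : r = nil
    · simp [hl, hr, run_nil, step]
    · simp [hl, run_nil, step, run_d1_of_ne_nil hr]
  · rw [step_run_false hl]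
    by_cases h : run u1 l = dead <;> simp [h, hl, step, run_dead]

theorem run_d2_node_ne_dead_iff (l r : BinaryTree Unit) :
    run d2 (node () l r) ≠ dead ↔
      ((l ≠ nil ∧ run u1 l ≠ dead) ∧ run d2 r ≠ dead) ∨ (l = nil ∧ r = nil) := by
  rw [run_node]
  by_cases hl : l = nil
  · by_cases hr : r = nil
    · simp [hl, hr, run_nil, step]
    · simp [hl, hr, run_nil, step, run_d1_of_ne_nil hr]
  · rw [step_run_false hl]
    by_cases h : run u1 l = dead <;> simp [h, hl, step, run_dead]

theorem run_u1_node_ne_dead_iff (l r : BinaryTree Unit) :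
    run u1 (node () l r) ≠ dead ↔ (l ≠ nil ∧ run u2 l ≠ dead) ∧ run d2 r ≠ dead := by
  rw [run_node]
  by_cases hl : l = nil
  · simp [hl, run_nil, step, run_dead]
  · rw [step_run_false hl]
    by_cases h : run u2 l = dead <;> simp [h, hl, step, run_dead]

theorem run_u2_node_ne_dead_iff (l r : BinaryTree Unit) :
    run u2 (node () l r) ≠ dead ↔ run u1 (node () l r) ≠ dead ∨ (l = nil ∧ r = nil) := by
  rw [run_u1_node_ne_dead_iff, run_node]
  by_cases hl : l = nil
  · by_cases hr : r = nil
    · simp [hl, hr, run_nil, step]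
    · simp [hl, hr, run_nil, step, run_d1_of_ne_nil hr]
  · rw [show step u2 true = u3 from rfl, step_run_false hl, run_u3_of_ne_nil hl]
    by_cases h : run u2 l = dead <;> simp [h, hl, run_dead]

/-! ### Generating functions of classes of binary trees -/

open Classical in
/-- The generating function by number of nodes of the binary trees satisfying `P`. -/
noncomputable def treeGF (P : BinaryTree Unit → Prop) : ℤ⟦X⟧ :=
  PowerSeries.mk fun n => (#{t ∈ treesOfNumNodesEq n | P t} : ℤ)

theorem treeGF_congr {P Q : BinaryTree Unit → Prop} (h : ∀ t, P t ↔ Q t) :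
    treeGF P = treeGF Q := by
  rw [show P = Q from funext fun t => propext (h t)]

theorem treeGF_or {P Q : BinaryTree Unit → Prop} (h : ∀ t, P t → ¬ Q t) :
    treeGF (fun t => P t ∨ Q t) = treeGF P + treeGF Q := by
  classical
  ext n
  simp only [treeGF, coeff_mk, map_add]
  rw [filter_or, card_union_of_disjoint (disjoint_filter.2 fun t _ => h t)]
  push_cast
  rfl

theorem treeGF_eq_single (t₀ : BinaryTree Unit) :
    treeGF (fun t => t = t₀) = PowerSeries.X ^ t₀.numNodes := by
  classical
  ext n
  simp only [treeGF, coeff_mk, coeff_X_pow, filter_eq', mem_treesOfNumNodesEq]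
  split_ifs with h1 h2 h2 <;> simp_all

theorem mem_pairwiseNode {A B : Finset (BinaryTree Unit)} {t : BinaryTree Unit} :
    t ∈ pairwiseNode A B ↔ ∃ l ∈ A, ∃ r ∈ B, node () l r = t := by
  simp only [pairwiseNode, mem_map, mem_product, Prod.exists]
  exact ⟨fun ⟨l, r, ⟨hl, hr⟩, h⟩ => ⟨l, hl, r, hr, h⟩, fun ⟨l, hl, r, hr, h⟩ => ⟨l, r, ⟨hl, hr⟩, h⟩⟩

theorem treeGF_node {P Q R : BinaryTree Unit → Prop} (h0 : ¬ P nil)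
    (h : ∀ l r, P (node () l r) ↔ Q l ∧ R r) :
    treeGF P = PowerSeries.X * (treeGF Q * treeGF R) := by
  classical
  ext n
  obtain _ | n := n
  · simp [treeGF, filter_singleton, h0]
  · rw [coeff_succ_X_mul, coeff_mul]
    simp only [treeGF, coeff_mk]
    have key : {t ∈ treesOfNumNodesEq (n + 1) | P t} =
        (antidiagonal n).biUnion fun ij =>
          pairwiseNode {t ∈ treesOfNumNodesEq ij.1 | Q t} {t ∈ treesOfNumNodesEq ij.2 | R t} := by
      ext t
      simp only [mem_filter, mem_biUnion, mem_pairwiseNode, mem_treesOfNumNodesEq,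
        HasAntidiagonal.mem_antidiagonal]
      constructor
      · rintro ⟨hn, ht⟩
        cases t with
        | nil => exact absurd ht h0
        | node a l r =>
          have hlr := (h l r).1 ht
          exact ⟨(l.numNodes, r.numNodes), by simpa [BinaryTree.numNodes] using hn,
            l, ⟨rfl, hlr.1⟩, r, ⟨rfl, hlr.2⟩, rfl⟩
      · rintro ⟨ij, hij, l, ⟨hl, hQ⟩, r, ⟨hr, hR⟩, rfl⟩
        exact ⟨by simp [BinaryTree.numNodes, hl, hr, hij], (h l r).2 ⟨hQ, hR⟩⟩
    rw [key, card_biUnion]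
    · simp [pairwiseNode]
    · intro i _ j _ hij
      rw [Function.onFun, disjoint_left]
      intro t h1 h2
      simp only [mem_filter, mem_pairwiseNode, mem_treesOfNumNodesEq] at h1 h2
      obtain ⟨l, ⟨hl, -⟩, r, ⟨hr, -⟩, rfl⟩ := h1
      obtain ⟨l', ⟨hl', -⟩, r', ⟨hr', -⟩, ht⟩ := h2
      injection ht with _ h3 h4
      subst h3 h4
      exact hij (Prod.ext (hl.symm.trans hl') (hr.symm.trans hr'))

/-! ### The functional equations -/

theorem treeGF_run_d2_eq_d2 :
    treeGF (fun t => run d2 t = d2) = 1 + PowerSeries.X *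
      (treeGF (fun t => t ≠ nil ∧ run u1 t ≠ dead) * treeGF (fun t => run d2 t = d2)) := by
  rw [← treeGF_node (P := fun t => t ≠ nil ∧ run d2 t = d2) (by simp)
      (fun l r => by simp [run_d2_node_eq_d2_iff]),
    show (1 : ℤ⟦X⟧) = treeGF (fun t => t = nil) by simp [treeGF_eq_single],
    ← treeGF_or (by tauto)]
  refine treeGF_congr fun t => ?_
  by_cases ht : t = nil <;> simp [ht, run_nil]

theorem treeGF_run_d2_ne_dead :
    treeGF (fun t => run d2 t ≠ dead) = 1 + PowerSeries.X + PowerSeries.X *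
      (treeGF (fun t => t ≠ nil ∧ run u1 t ≠ dead) * treeGF (fun t => run d2 t ≠ dead)) := by
  rw [← treeGF_node (P := fun t => (t ≠ nil ∧ t ≠ node () nil nil) ∧ run d2 t ≠ dead) (by simp)
      (fun l r => by rw [run_d2_node_ne_dead_iff]; simp; tauto),
    show (1 : ℤ⟦X⟧) = treeGF (fun t => t = nil) by simp [treeGF_eq_single],
    show (PowerSeries.X : ℤ⟦X⟧) = treeGF (fun t => t = node () nil nil) by
      simp [treeGF_eq_single],
    ← treeGF_or (by rintro t rfl; simp), ← treeGF_or (by tauto)]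
  refine treeGF_congr fun t => ?_
  by_cases ht : t = nil
  · simp [ht, run_nil]
  · by_cases ht' : t = node () nil nil
    · simp [ht', run_node, run_nil, step]
    · simp [ht, ht']

theorem treeGF_run_u1_ne_dead :
    treeGF (fun t => t ≠ nil ∧ run u1 t ≠ dead) = PowerSeries.X *
      (treeGF (fun t => t ≠ nil ∧ run u2 t ≠ dead) * treeGF (fun t => run d2 t ≠ dead)) :=
  treeGF_node (by simp) fun l r => by rw [run_u1_node_ne_dead_iff]; simp

theorem treeGF_run_u2_ne_dead :
    treeGF (fun t => t ≠ nil ∧ run u2 t ≠ dead) =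
      treeGF (fun t => t ≠ nil ∧ run u1 t ≠ dead) + PowerSeries.X := by
  rw [show (PowerSeries.X : ℤ⟦X⟧) = treeGF (fun t => t = node () nil nil) by
      simp [treeGF_eq_single],
    ← treeGF_or]
  · refine treeGF_congr fun t => ?_
    cases t with
    | nil => simp
    | node a l r => simpa using run_u2_node_ne_dead_iff l r
  · rintro t ⟨-, h⟩ rfl
    simp [run_u1_node_ne_dead_iff] at h

theorem card_paths_eq (n : ℕ) :
    Nat.card {w : List Bool // IsDyck w ∧ w.count true = n ∧
      (∀ i, IsPeakAt w i → ht w (i + 1) ≠ 1) ∧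
      (∀ i l, AscRun w i l → l ≠ 2) ∧
      (∀ i l, DescRun w i l → l ≠ 1)} =
    #{t ∈ treesOfNumNodesEq n | run d2 t = d2} := by
  rw [← Nat.card_eq_finsetCard]
  refine (Nat.card_congr ?_).symm
  refine (treeEquiv.subtypeEquiv (q := fun w => w.1.count true = n ∧
    (∀ i, IsPeakAt w.1 i → ht w.1 (i + 1) ≠ 1) ∧
    (∀ i l, AscRun w.1 i l → l ≠ 2) ∧ (∀ i l, DescRun w.1 i l → l ≠ 1)) fun t => ?_).trans
    (Equiv.subtypeSubtypeEquivSubtypeInter IsDyck fun w => w.count true = n ∧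
      (∀ i, IsPeakAt w i → ht w (i + 1) ≠ 1) ∧
      (∀ i l, AscRun w i l → l ≠ 2) ∧ ∀ i l, DescRun w i l → l ≠ 1)
  have hd : IsDyck (word t) := (treeEquiv t).2
  change _ ↔ (word t).count true = n ∧ (∀ i, IsPeakAt (word t) i → ht (word t) (i + 1) ≠ 1) ∧
    (∀ i l, AscRun (word t) i l → l ≠ 2) ∧ (∀ i l, DescRun (word t) i l → l ≠ 1)
  rw [mem_filter, mem_treesOfNumNodesEq, count_true_word, run,
    foldl_step_eq_d2_iff (head_ne_false_of_isDyck hd) (getLast_ne_true_of_isDyck hd)]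
  exact and_congr_right fun _ => ⟨fun h => ⟨peak_height_ne_one_of_isDyck hd h.2, h⟩, fun h => h.2⟩

end DyckRuns

/-- If `a n` counts Dyck paths of semi-length `n` with no peak of height `1`, no
maximal ascending run of length `2`, and no maximal descending run of length
`1`, then `f = ∑ a(n) xⁿ` over `ℤ` satisfies
`1 + (-x² - x - 1) f + (x⁴ + x³ + x² + x) f² = 0`. -/
theorem statement9 (a : ℕ → ℕ)
    (ha : ∀ n, a n = Nat.card {w : List Bool // IsDyck w ∧ w.count true = n ∧
      (∀ i, IsPeakAt w i → ht w (i + 1) ≠ 1) ∧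
      (∀ i l, AscRun w i l → l ≠ 2) ∧
      (∀ i l, DescRun w i l → l ≠ 1)})
    (f : PowerSeries ℤ) (hf : f = PowerSeries.mk fun n => (a n : ℤ)) :
    1 + (-PowerSeries.X ^ 2 - PowerSeries.X - 1) * f +
      (PowerSeries.X ^ 4 + PowerSeries.X ^ 3 + PowerSeries.X ^ 2 + PowerSeries.X) * f ^ 2
      = 0 := by
  have hfF : f = DyckRuns.treeGF (fun t => DyckRuns.run .d2 t = .d2) := by
    rw [hf, DyckRuns.treeGF]
    congr 1
    funext n
    rw [ha, DyckRuns.card_paths_eq]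
    congr!
  have h1 := DyckRuns.treeGF_run_d2_eq_d2
  have h2 := DyckRuns.treeGF_run_d2_ne_dead
  have h3 := DyckRuns.treeGF_run_u1_ne_dead
  rw [DyckRuns.treeGF_run_u2_ne_dead] at h3
  rw [← hfF] at h1
  generalize DyckRuns.treeGF (fun t => DyckRuns.run .d2 t ≠ .dead) = M at h2 h3
  generalize DyckRuns.treeGF (fun t => t ≠ .nil ∧ DyckRuns.run .u1 t ≠ .dead) = S at h1 h2 h3
  have hM : M = (1 + X) * f := by linear_combination f * h2 - M * h1
  rw [hM] at h3
  linear_combination (-X * f) * h3 + (X * (1 + X) * f - 1) * h1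
end

section
/- Let a(n) be the number of Dyck paths of semi-length n with no maximal ascending run whose length lies in the set {2r+3 : r >= 0} = {3, 5, 7, 9, ...} of odd integers at least 3, and let P = \sum_{n\ge 0} a(n) x^n in the ring of formal power series over the integers. Then -1 + (1 - x) P + x^2 (x - 1) P^3 = 0. -/
open Finset PowerSeries

/-- All ascending runs of `w` have a length satisfying `q`, except that the (possibly empty)
initial one has a length satisfying `p`. -/
def RunsSatisfy (q : ℕ → Prop) : (ℕ → Prop) → List Bool → Prop
  | p, [] => p 0
  | p, true :: w => RunsSatisfy q (fun k => p (k + 1)) w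
  | p, false :: w => p 0 ∧ RunsSatisfy q q w

theorem runsSatisfy_append_false_cons (q : ℕ → Prop) (v : List Bool) (p : ℕ → Prop)
    (u : List Bool) :
    RunsSatisfy q p (u ++ false :: v) ↔ RunsSatisfy q p u ∧ RunsSatisfy q q v := by
  induction u generalizing p with
  | nil => simp [RunsSatisfy]
  | cons b u ih => cases b <;> simp [RunsSatisfy, ih, and_assoc]

theorem ascRun_replicate (c i l : ℕ) :
    AscRun (List.replicate c true) i l ↔ i = 0 ∧ l = c ∧ 1 ≤ c := by
  simp only [AscRun, List.getElem?_replicate]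
  constructor
  · rintro ⟨h1, h2, h3, h4⟩
    have hlast := h2 (l - 1) (by omega)
    rcases i with _ | i
    · grind
    · have := h3 i rfl
      grind
  · rintro ⟨rfl, rfl, h⟩
    grind

theorem getElem?_replicate_append_false_cons (c k : ℕ) (w : List Bool) :
    (List.replicate c true ++ false :: w)[k]? =
      if k < c then some true else if k = c then some false else w[k - (c + 1)]? := by
  grind

theorem ascRun_replicate_append_false_cons (c i l : ℕ) (w : List Bool) :
    AscRun (List.replicate c true ++ false :: w) i l ↔
      (i = 0 ∧ l = c ∧ 1 ≤ c) ∨ ∃ k, i = c + 1 + k ∧ AscRun w k l := by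
  simp only [AscRun, getElem?_replicate_append_false_cons]
  constructor
  · rintro ⟨h1, h2, h3, h4⟩
    rcases lt_trichotomy i c with hi | hi | hi
    · left
      obtain rfl : i = 0 := by
        rcases i with _ | i
        · rfl
        · have := h3 i rfl
          grind
      have := h2 c
      grind
    · have := h2 0 (by omega)
      grind
    · right
      obtain ⟨k, rfl⟩ : ∃ k, i = c + 1 + k := ⟨i - (c + 1), by omega⟩
      refine ⟨k, rfl, h1, fun j hj => ?_, fun k' hk => ?_, ?_⟩
      · have := h2 j hj
        grind
      · have := h3 (c + 1 + k') (by omega)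
        grind
      · grind
  · rintro (⟨rfl, rfl, h⟩ | ⟨k, rfl, h1, h2, h3, h4⟩)
    · grind
    · refine ⟨h1, fun j hj => ?_, fun i' hi => ?_, ?_⟩
      · have := h2 j hj
        grind
      · rcases k with _ | k
        · grind
        · have := h3 k rfl
          grind
      · grind

theorem forall_ascRun_iff_runsSatisfy {q : ℕ → Prop} (hq : q 0) (c : ℕ) (w : List Bool) :
    (∀ i l, AscRun (List.replicate c true ++ w) i l → q l) ↔
      RunsSatisfy q (fun k => q (k + c)) w := by
  induction w generalizing c with
  | nil =>
    simp only [List.append_nil, ascRun_replicate, RunsSatisfy]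
    rcases c with _ | c <;> simp [hq]
  | cons b w ih =>
    cases b
    · have h0 := ih 0
      simp only [List.replicate_zero, List.nil_append, Nat.add_zero] at h0
      simp only [RunsSatisfy, ascRun_replicate_append_false_cons, ← h0, Nat.zero_add]
      constructor
      · intro h
        refine ⟨?_, fun i l hl => h _ l (Or.inr ⟨i, rfl, hl⟩)⟩
        rcases c with _ | c
        · exact hq
        · exact h 0 _ (Or.inl ⟨rfl, rfl, by omega⟩)
      · rintro ⟨hc, h⟩ i l (⟨-, rfl, -⟩ | ⟨k, -, hk⟩)
        · exact hc
        · exact h k l hk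
    · have : List.replicate c true ++ true :: w = List.replicate (c + 1) true ++ w := by
        simp [List.replicate_succ']
      rw [this, ih, RunsSatisfy]
      simp only [Nat.add_assoc, Nat.add_comm 1 c]

/-- The counterpart of `RunsSatisfy` for the binary tree of a Dyck path. -/
def TreeRunsSatisfy (q : ℕ → Prop) : (ℕ → Prop) → BinaryTree Unit → Prop
  | p, .nil => p 0
  | p, .node _ l r => TreeRunsSatisfy q (fun k => p (k + 1)) l ∧ TreeRunsSatisfy q q r

/-- Up-steps are `true` and down-steps are `false`. -/
def dyckStepEquivBool : DyckStep ≃ Bool where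
  toFun s := match s with
    | .U => true
    | .D => false
  invFun b := match b with
    | true => .U
    | false => .D
  left_inv s := by cases s <;> rfl
  right_inv b := by cases b <;> rfl

theorem count_true_map (l : List DyckStep) :
    (l.map dyckStepEquivBool).count true = l.count .U :=
  List.count_map_of_injective l _ dyckStepEquivBool.injective .U

theorem count_false_map (l : List DyckStep) :
    (l.map dyckStepEquivBool).count false = l.count .D :=
  List.count_map_of_injective l _ dyckStepEquivBool.injective .D

theorem count_U_map (l : List Bool) :
    (l.map dyckStepEquivBool.symm).count .U = l.count true :=
  List.count_map_of_injective l _ dyckStepEquivBool.symm.injective true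

theorem count_D_map (l : List Bool) :
    (l.map dyckStepEquivBool.symm).count .D = l.count false :=
  List.count_map_of_injective l _ dyckStepEquivBool.symm.injective false

/-- Mathlib's Dyck words are the Boolean words satisfying `IsDyck`. -/
def dyckWordEquiv : DyckWord ≃ {w : List Bool // IsDyck w} where
  toFun p := ⟨p.toList.map dyckStepEquivBool, by
    simp only [IsDyck, ← List.map_take, count_true_map, count_false_map]
    exact ⟨p.count_U_eq_count_D, p.count_D_le_count_U⟩⟩
  invFun w := ⟨w.1.map dyckStepEquivBool.symm, by
    simpa only [count_U_map, count_D_map] using w.2.1, by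
    simpa only [← List.map_take, count_U_map, count_D_map] using w.2.2⟩
  left_inv p := by ext1; simp
  right_inv w := by ext1; simp

theorem runsSatisfy_dyckWordEquiv_ofTree (q p : ℕ → Prop) (t : BinaryTree Unit) :
    RunsSatisfy q p (dyckWordEquiv (DyckWord.ofTree t)).1 ↔ TreeRunsSatisfy q p t := by
  induction t generalizing p with
  | nil => rfl
  | node _ l r ihl ihr =>
    have : (dyckWordEquiv (DyckWord.ofTree (.node () l r))).1 =
        true :: ((dyckWordEquiv (DyckWord.ofTree l)).1 ++
          false :: (dyckWordEquiv (DyckWord.ofTree r)).1) := by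
      change List.map _ (([DyckStep.U] ++ _ ++ [DyckStep.D]) ++ _) = _
      simp [dyckWordEquiv, dyckStepEquivBool]
    rw [this, RunsSatisfy, runsSatisfy_append_false_cons, ihl, ihr, TreeRunsSatisfy]

open Classical in
theorem card_dyck_eq_card_trees {q : ℕ → Prop} (hq : q 0) (n : ℕ) :
    Nat.card {w : List Bool // IsDyck w ∧ w.count true = n ∧ ∀ i l, AscRun w i l → q l} =
      #{t ∈ BinaryTree.treesOfNumNodesEq n | TreeRunsSatisfy q q t} := by
  let e : BinaryTree Unit ≃ {w : List Bool // IsDyck w} :=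
    DyckWord.equivTree.symm.trans dyckWordEquiv
  have key (t : BinaryTree Unit) :
      t ∈ ({t ∈ BinaryTree.treesOfNumNodesEq n | TreeRunsSatisfy q q t} : Finset _) ↔
        (e t).1.count true = n ∧ ∀ i l, AscRun (e t).1 i l → q l := by
    have h1 : (e t).1.count true = t.numNodes := by
      rw [← DyckWord.toTree_ofTree t, DyckWord.numNodes_toTree, DyckWord.toTree_ofTree]
      exact count_true_map _
    have h2 := forall_ascRun_iff_runsSatisfy hq 0 (e t).1
    simp only [List.replicate_zero, List.nil_append, Nat.add_zero] at h2
    rw [Finset.mem_filter, BinaryTree.mem_treesOfNumNodesEq, h1, h2]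
    exact and_congr_right fun _ => (runsSatisfy_dyckWordEquiv_ofTree q q t).symm
  rw [← Nat.card_eq_finsetCard]
  exact Nat.card_congr ((Equiv.subtypeSubtypeEquivSubtypeInter _ fun w : List Bool =>
    w.count true = n ∧ ∀ i l, AscRun w i l → q l).symm.trans (e.subtypeEquiv key).symm)

open Classical in
/-- The generating function, by number of nodes, of the trees satisfying
`TreeRunsSatisfy q p`. -/
noncomputable def treeRunsSeries (q p : ℕ → Prop) : PowerSeries ℤ :=
  PowerSeries.mk fun n =>
    (#{t ∈ BinaryTree.treesOfNumNodesEq n | TreeRunsSatisfy q p t} : ℤ)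

open Classical in
theorem treeRunsSeries_eq (q p : ℕ → Prop) :
    treeRunsSeries q p = (if p 0 then 1 else 0) +
      X * (treeRunsSeries q (fun k => p (k + 1)) * treeRunsSeries q q) := by
  ext n
  rcases n with _ | n
  · by_cases h : p 0 <;>
      simp [treeRunsSeries, Finset.filter_singleton, TreeRunsSatisfy, h]
  · have hc : coeff (n + 1) (if p 0 then 1 else 0 : PowerSeries ℤ) = 0 := by
      split_ifs <;> simp [coeff_one]
    rw [map_add, hc, zero_add, coeff_succ_X_mul, coeff_mul]
    simp only [treeRunsSeries, coeff_mk]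
    rw [BinaryTree.treesOfNumNodesEq_succ, Finset.filter_biUnion, Finset.card_biUnion]
    · push_cast
      refine Finset.sum_congr rfl fun ij _ => ?_
      rw [Finset.filter_map, Finset.card_map, ← Nat.cast_mul, ← Finset.card_product,
        ← Finset.filter_product]
      congr 2
      exact Finset.filter_congr fun _ _ => Iff.rfl
    · intro ij _ ij' _ hne
      rw [Function.onFun, Finset.disjoint_left]
      intro t ht ht'
      simp only [Finset.mem_filter, Finset.mem_map, Finset.mem_product,
        BinaryTree.mem_treesOfNumNodesEq] at ht ht'
      obtain ⟨⟨x, ⟨hx1, hx2⟩, rfl⟩, -⟩ := ht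
      obtain ⟨⟨y, ⟨hy1, hy2⟩, hxy⟩, -⟩ := ht'
      injection hxy with _ hl hr
      exact hne (Prod.ext (by rw [← hx1, ← hy1, hl]) (by rw [← hx2, ← hy2, hr]))

/-- If `a n` counts Dyck paths of semi-length `n` with no maximal ascending run
whose length is an odd number at least `3` (i.e. lies in `{2r+3 : r ≥ 0}`),
then `P = ∑ a(n) xⁿ` over `ℤ` satisfies `-1 + (1 - x) P + x² (x - 1) P³ = 0`. -/
theorem statement15 (a : ℕ → ℕ)
    (ha : ∀ n, a n = Nat.card {w : List Bool // IsDyck w ∧ w.count true = n ∧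
      ∀ i l, AscRun w i l → ∀ r : ℕ, l ≠ 2 * r + 3})
    (P : PowerSeries ℤ) (hP : P = PowerSeries.mk fun n => (a n : ℤ)) :
    -1 + (1 - X) * P + X ^ 2 * (X - 1) * P ^ 3 = 0 := by
  let q : ℕ → Prop := fun l => ∀ r : ℕ, l ≠ 2 * r + 3
  have hPq : P = treeRunsSeries q q := by
    rw [hP]
    ext n
    simp only [treeRunsSeries, coeff_mk, ha]
    exact_mod_cast card_dyck_eq_card_trees (q := q) (fun r => by omega) n
  have q_add_two : (fun k => q (k + 1 + 1)) = Even := by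
    ext k
    rw [Nat.even_iff]
    exact ⟨fun h => by have := h ((k - 1) / 2); omega, fun h r => by omega⟩
  have even_add_two : (fun k => Even (k + 1 + 1)) = Even := by
    ext k
    simp [Nat.even_add_one]
  have h0 := treeRunsSeries_eq q q
  have h1 := treeRunsSeries_eq q fun k => q (k + 1)
  have h2 := treeRunsSeries_eq q Even
  have h3 := treeRunsSeries_eq q fun k => Even (k + 1)
  rw [if_pos (fun r => by omega), ← hPq] at h0
  rw [if_pos (fun r => by omega), q_add_two, ← hPq] at h1
  rw [if_pos (by decide), ← hPq] at h2
  rw [if_neg (by decide), even_add_two, ← hPq] at h3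
  rw [h1] at h0
  rw [h3] at h2
  linear_combination (1 - X ^ 2 * P ^ 2) * h0 + X ^ 2 * P ^ 2 * h2
end

section
/- Let a(n) be the number of Dyck paths of semi-length n with no maximal ascending run of even length and no maximal descending run of odd length, and let P = \sum_{n\ge 0} a(n) x^n in the ring of formal power series over the integers. Then 1 - (x^2 + 1) P - x^2 P^2 + x^2 (3x^2 + 2) P^3 - x^4 P^4 - x^4 (x^2 + 1) P^5 + x^6 P^6 = 0. -/
open Finset PowerSeries

/-- A scanner reading a word from left to right which checks that all maximal runs of the letter
`b` have a length satisfying `Q`, where `c` letters `b` are prepended to the word. -/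
def RunScan (b : Bool) (Q : ℕ → Prop) : ℕ → List Bool → Prop
  | c, [] => c = 0 ∨ Q c
  | c, x :: w => if x = b then RunScan b Q (c + 1) w else (c = 0 ∨ Q c) ∧ RunScan b Q 0 w

/-- The word `w` has a maximal run of the letter `b` starting at `i` and of length `l`. -/
def LetterRun (b : Bool) (w : List Bool) (i l : ℕ) : Prop :=
  1 ≤ l ∧ (∀ j < l, w[i + j]? = some b) ∧
    (∀ i', i = i' + 1 → w[i']? = some (!b)) ∧ w[i + l]? ≠ some b

lemma letterRun_replicate (b : Bool) (c i l : ℕ) :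
    LetterRun b (List.replicate c b) i l ↔ i = 0 ∧ l = c ∧ 1 ≤ c := by
  have hf : ∀ k, (List.replicate c b)[k]? = if k < c then some b else none := fun k => by
    simp [List.getElem?_replicate]
  unfold LetterRun
  simp only [hf]
  constructor
  · rintro ⟨h1, h2, h3, h4⟩
    have hi : i = 0 := by
      rcases i with _ | i
      · rfl
      · have := h3 i rfl
        split_ifs at this
        simp at this
    subst hi
    have h5 := h2 (l - 1) (by omega)
    simp only [Option.ite_none_right_eq_some, ne_eq] at h4 h5
    simp only [and_true, not_lt] at h4
    omega
  · rintro ⟨rfl, rfl, h⟩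
    refine ⟨h, fun j hj => by simp [hj], fun i' h => by omega, by simp⟩

lemma letterRun_replicate_append (b : Bool) (w : List Bool) (c i l : ℕ) :
    LetterRun b (List.replicate c b ++ (!b) :: w) i l ↔
      (i = 0 ∧ l = c ∧ 1 ≤ c) ∨ ∃ k, i = c + 1 + k ∧ LetterRun b w k l := by
  obtain ⟨f, hf⟩ : ∃ f : ℕ → Option Bool,
      ∀ k, (List.replicate c b ++ (!b) :: w)[k]? = f k := ⟨_, fun _ => rfl⟩
  have h_lt : ∀ k < c, f k = some b := fun k hk => by
    rw [← hf, List.getElem?_append_left (by simpa using hk)]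
    simp [hk]
  have h_eq : f c = some (!b) := by
    rw [← hf, List.getElem?_append_right (by simp)]
    simp
  have h_gt : ∀ k, f (c + 1 + k) = w[k]? := fun k => by
    rw [← hf, List.getElem?_append_right (by simp; omega)]
    simp [show c + 1 + k - c = k + 1 by omega]
  have hb : some (!b) ≠ some b := by simp
  unfold LetterRun
  simp only [hf]
  constructor
  · rintro ⟨h1, h2, h3, h4⟩
    rcases Nat.lt_or_ge c i with hi | hi
    · obtain ⟨k, rfl⟩ := Nat.exists_eq_add_of_lt hi
      refine Or.inr ⟨k, by omega, h1, fun j hj => ?_, ?_, ?_⟩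
      · rw [← h_gt, ← h2 j hj]
        congr 1
        omega
      · rintro k' rfl
        rw [← h_gt]
        exact h3 _ (by omega)
      · rw [← h_gt]
        rwa [show c + 1 + (k + l) = c + k + 1 + l by omega]
    · rcases i with _ | i
      · refine Or.inl ⟨rfl, ?_⟩
        simp only [Nat.zero_add] at h2 h4
        have hlc : l ≤ c := by
          by_contra! h
          exact hb (h_eq.symm.trans (h2 c h))
        have hcl : c ≤ l := by
          by_contra! h
          exact h4 (h_lt l h)
        omega
      · exact absurd ((h3 i rfl).symm.trans (h_lt i (by omega))) hb
  · rintro (⟨rfl, rfl, h⟩ | ⟨k, rfl, h1, h2, h3, h4⟩)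
    · refine ⟨h, fun j hj => ?_, fun i' h => by omega, ?_⟩
      · rw [Nat.zero_add]
        exact h_lt j hj
      · rw [Nat.zero_add, h_eq]
        exact hb
    · refine ⟨h1, fun j hj => ?_, fun i' hi' => ?_, ?_⟩
      · rw [Nat.add_assoc, h_gt]
        exact h2 j hj
      · rcases k with _ | k
        · obtain rfl : i' = c := by omega
          exact h_eq
        · obtain rfl : i' = c + 1 + k := by omega
          rw [h_gt]
          exact h3 k rfl
      · rw [Nat.add_assoc, h_gt]
        exact h4

lemma forall_letterRun_replicate_append_iff (b : Bool) (Q : ℕ → Prop) (c : ℕ) (w : List Bool) :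
    (∀ i l, LetterRun b (List.replicate c b ++ w) i l → Q l) ↔ RunScan b Q c w := by
  induction w generalizing c with
  | nil =>
    simp only [List.append_nil, letterRun_replicate, RunScan]
    constructor
    · intro h
      rcases Nat.eq_zero_or_pos c with hc | hc
      · exact Or.inl hc
      · exact Or.inr (h 0 c ⟨rfl, rfl, hc⟩)
    · rintro h i l ⟨rfl, rfl, hl⟩
      exact h.resolve_left (by omega)
  | cons x w ih =>
    by_cases hx : x = b
    · subst hx
      have : List.replicate c x ++ x :: w = List.replicate (c + 1) x ++ w := by
        simp [List.replicate_succ']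
      rw [this, ih, RunScan, if_pos rfl]
    · obtain rfl : x = !b := by
        cases x <;> cases b <;> simp_all
      have h0 := ih 0
      simp only [List.replicate_zero, List.nil_append] at h0
      rw [RunScan, if_neg hx, ← h0]
      simp only [letterRun_replicate_append]
      constructor
      · intro h
        refine ⟨?_, fun i l hl => h _ l (Or.inr ⟨i, rfl, hl⟩)⟩
        rcases Nat.eq_zero_or_pos c with hc | hc
        · exact Or.inl hc
        · exact Or.inr (h 0 c (Or.inl ⟨rfl, rfl, hc⟩))
      · rintro ⟨h, h'⟩ i l (⟨rfl, rfl, hl⟩ | ⟨k, rfl, hk⟩)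
        · exact h.resolve_left (by omega)
        · exact h' k l hk

lemma forall_letterRun_iff (b : Bool) (Q : ℕ → Prop) (w : List Bool) :
    (∀ i l, LetterRun b w i l → Q l) ↔ RunScan b Q 0 w := by
  simpa using forall_letterRun_replicate_append_iff b Q 0 w

lemma runScan_append (b : Bool) (Q : ℕ → Prop) (c : ℕ) (u v : List Bool) :
    RunScan b Q c (u ++ (!b) :: v) ↔ RunScan b Q c u ∧ RunScan b Q 0 v := by
  induction u generalizing c with
  | nil => simp [RunScan]
  | cons x u ih =>
    by_cases hx : x = b <;> simp [RunScan, hx, ih, and_assoc]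

lemma runScan_replicate_append (b : Bool) (Q : ℕ → Prop) (c d : ℕ) (w : List Bool) :
    RunScan b Q d (List.replicate c b ++ w) ↔ RunScan b Q (d + c) w := by
  induction c generalizing d with
  | zero => simp
  | succ c ih => simp [List.replicate_succ, RunScan, ih, Nat.add_assoc, Nat.add_comm 1 c]

lemma runScan_reverse_append_replicate (b : Bool) (Q : ℕ → Prop) (c : ℕ) (w : List Bool) :
    RunScan b Q 0 (w.reverse ++ List.replicate c b) ↔ RunScan b Q c w := by
  induction w generalizing c with
  | nil => simpa using runScan_replicate_append b Q c 0 []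
  | cons x w ih =>
    by_cases hx : x = b
    · subst hx
      rw [RunScan, if_pos rfl, ← ih]
      simp [List.replicate_succ]
    · obtain rfl : x = !b := by
        cases x <;> cases b <;> simp_all
      have h1 := runScan_replicate_append b Q c 0 []
      have h2 := ih 0
      simp only [List.append_nil, Nat.zero_add, List.replicate_zero] at h1 h2
      rw [RunScan, if_neg hx, List.reverse_cons, List.append_assoc, List.singleton_append,
        runScan_append, h1, h2, RunScan, and_comm]

lemma runScan_reverse (b : Bool) (Q : ℕ → Prop) (w : List Bool) :
    RunScan b Q 0 w.reverse ↔ RunScan b Q 0 w := by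
  simpa using runScan_reverse_append_replicate b Q 0 w

lemma runScan_congr (b : Bool) (Q : ℕ → Prop) {c d : ℕ}
    (h : ∀ k, (c + k = 0 ∨ Q (c + k)) ↔ (d + k = 0 ∨ Q (d + k))) (w : List Bool) :
    RunScan b Q c w ↔ RunScan b Q d w := by
  induction w generalizing c d with
  | nil => simpa [RunScan] using h 0
  | cons x w ih =>
    by_cases hx : x = b
    · simp only [RunScan, hx, if_true]
      refine ih fun k => ?_
      rw [Nat.add_assoc, Nat.add_assoc]
      exact h (1 + k)
    · simpa [RunScan, hx] using and_congr_left fun _ => h 0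

open BinaryTree

/-- The Dyck path of a binary tree, obtained from the first return decomposition. -/
def treePath : BinaryTree Unit → List Bool
  | nil => []
  | node _ l r => true :: (treePath l ++ false :: treePath r)

/-- The map from Dyck steps to letters sending `U` to `true` and `D` to `false`. -/
def stepLetter : DyckStep → Bool
  | .U => true
  | .D => false

lemma stepLetter_injective : Function.Injective stepLetter := by
  rintro (_ | _) (_ | _) h <;> simp_all [stepLetter]

lemma map_ofTree (t : BinaryTree Unit) :
    (DyckWord.ofTree t).toList.map stepLetter = treePath t := by
  induction t with
  | nil => rfl
  | node _ l r hl hr =>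
    change List.map stepLetter ((DyckStep.U :: ((DyckWord.ofTree l).toList ++ [DyckStep.D])) ++
      (DyckWord.ofTree r).toList) = _
    simp [treePath, hl, hr, stepLetter]

lemma treePath_injective : Function.Injective treePath := by
  intro s t h
  rw [← map_ofTree, ← map_ofTree] at h
  exact DyckWord.equivTree.symm.injective
    (DyckWord.ext (stepLetter_injective.list_map h))

lemma count_map_stepLetter (s : DyckStep) (w : List DyckStep) :
    (w.map stepLetter).count (stepLetter s) = w.count s :=
  List.count_map_of_injective w stepLetter stepLetter_injective s

lemma isDyck_treePath (t : BinaryTree Unit) : IsDyck (treePath t) := by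
  rw [← map_ofTree]
  refine ⟨?_, fun k => ?_⟩
  · exact (count_map_stepLetter .U _).trans
      ((DyckWord.ofTree t).count_U_eq_count_D.trans (count_map_stepLetter .D _).symm)
  · rw [← List.map_take]
    exact (count_map_stepLetter .D _).trans_le
      (((DyckWord.ofTree t).count_D_le_count_U k).trans (count_map_stepLetter .U _).ge)

lemma exists_treePath_eq {w : List Bool} (hw : IsDyck w) : ∃ t, treePath t = w := by
  obtain ⟨v, rfl⟩ : ∃ v : List DyckStep, v.map stepLetter = w := by
    refine ⟨w.map fun b => if b then .U else .D, ?_⟩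
    rw [List.map_map, List.map_congr_left (g := id), List.map_id]
    rintro (_ | _) _ <;> rfl
  refine ⟨DyckWord.toTree ⟨v, ?_, fun k => ?_⟩, ?_⟩
  · exact (count_map_stepLetter .U v).symm.trans (hw.1.trans (count_map_stepLetter .D v))
  · have h := hw.2 k
    rw [← List.map_take] at h
    exact (count_map_stepLetter .D _).symm.trans_le (h.trans (count_map_stepLetter .U _).le)
  · rw [← map_ofTree, DyckWord.ofTree_toTree]

lemma count_true_treePath (t : BinaryTree Unit) : (treePath t).count true = t.numNodes := by
  induction t with
  | nil => rfl
  | node _ l r hl hr => simp [treePath, hl, hr, numNodes]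

/-- The generating function of binary trees by number of nodes, with weights. -/
noncomputable def treeGF (f : BinaryTree Unit → ℤ) : PowerSeries ℤ :=
  PowerSeries.mk fun n => ∑ t ∈ treesOfNumNodesEq n, f t

lemma treeGF_sub (f g : BinaryTree Unit → ℤ) :
    treeGF (fun t => f t - g t) = treeGF f - treeGF g := by
  ext n
  simp [treeGF, Finset.sum_sub_distrib]

lemma treeGF_ite_nil (z : ℤ) : treeGF (fun t => if t = nil then z else 0) = C z := by
  ext n
  rw [treeGF, coeff_mk, Finset.sum_ite_eq', coeff_C]
  simp [mem_treesOfNumNodesEq, numNodes, eq_comm]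

lemma sum_treesOfNumNodesEq_succ (f : BinaryTree Unit → ℤ) (n : ℕ) :
    ∑ t ∈ treesOfNumNodesEq (n + 1), f t = ∑ p ∈ antidiagonal n,
      ∑ l ∈ treesOfNumNodesEq p.1, ∑ r ∈ treesOfNumNodesEq p.2, f (l △ r) := by
  rw [treesOfNumNodesEq_succ, Finset.sum_biUnion]
  · refine Finset.sum_congr rfl fun p _ => ?_
    rw [pairwiseNode, Finset.sum_map, Finset.sum_product]
    rfl
  · simp_rw [Set.PairwiseDisjoint, Set.Pairwise, Function.onFun, Finset.disjoint_left]
    rintro ⟨i, j⟩ _ ⟨i', j'⟩ _ hne t ht ht'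
    simp only [pairwiseNode, Finset.mem_map, Finset.mem_product, mem_treesOfNumNodesEq] at ht ht'
    obtain ⟨⟨l, r⟩, ⟨rfl, rfl⟩, rfl⟩ := ht
    obtain ⟨⟨l', r'⟩, ⟨rfl, rfl⟩, h⟩ := ht'
    simp_all

lemma treeGF_of_node {f g h g' h' : BinaryTree Unit → ℤ}
    (h_node : ∀ l r, f (l △ r) = g l * h r + g' l * h' r) :
    treeGF f = C (f nil) + X * (treeGF g * treeGF h + treeGF g' * treeGF h') := by
  ext n
  rcases n with _ | n
  · simp [treeGF]
  · rw [map_add, coeff_succ_X_mul, map_add, coeff_mul, coeff_mul, coeff_C,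
      if_neg n.succ_ne_zero, treeGF, coeff_mk, sum_treesOfNumNodesEq_succ]
    simp [treeGF, h_node, Finset.sum_mul_sum, Finset.sum_add_distrib]

open Classical in
/-- The indicator of the trees whose path satisfies the conditions on runs, with the first
ascending run lengthened by `a` and the last descending run lengthened by `d`. -/
noncomputable def runWeight (a d : ℕ) (t : BinaryTree Unit) : ℤ :=
  if RunScan true Odd a (treePath t) ∧ RunScan false Even d (treePath t).reverse then 1 else 0

lemma runWeight_nil (a d : ℕ) [Decidable ((a = 0 ∨ Odd a) ∧ (d = 0 ∨ Even d))] :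
    runWeight a d nil = if (a = 0 ∨ Odd a) ∧ (d = 0 ∨ Even d) then 1 else 0 := by
  simp [runWeight, treePath, RunScan]

lemma runScan_true_node (Q : ℕ → Prop) (a : ℕ) (l r : BinaryTree Unit) :
    RunScan true Q a (treePath (l △ r)) ↔
      RunScan true Q (a + 1) (treePath l) ∧ RunScan true Q 0 (treePath r) := by
  rw [treePath, RunScan, if_pos rfl]
  exact runScan_append true Q (a + 1) (treePath l) (treePath r)

lemma runScan_false_reverse_node_nil (Q : ℕ → Prop) (d : ℕ) (l : BinaryTree Unit) :
    RunScan false Q d (treePath (l △ nil)).reverse ↔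
      RunScan false Q (d + 1) (treePath l).reverse := by
  have h := runScan_append false Q (d + 1) (treePath l).reverse []
  simp only [Bool.not_false] at h
  simp [treePath, RunScan, h]

lemma runScan_false_reverse_node_node (Q : ℕ → Prop) (d : ℕ) (l r s : BinaryTree Unit) :
    RunScan false Q d (treePath (l △ (r △ s))).reverse ↔
      RunScan false Q 1 (treePath l).reverse ∧
        RunScan false Q d (treePath (r △ s)).reverse := by
  have h := fun c u v => runScan_append false Q c u v
  simp only [Bool.not_false] at h
  have e : (treePath (l △ (r △ s))).reverse =
      ((treePath s).reverse ++ false :: (treePath r).reverse) ++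
        true :: (false :: (treePath l).reverse ++ true :: []) := by
    simp [treePath]
  have e' : (treePath (r △ s)).reverse =
      ((treePath s).reverse ++ false :: (treePath r).reverse) ++ true :: [] := by
    simp [treePath]
  rw [e, e', h, h, h]
  simp [RunScan, and_comm]

open Classical in
lemma runWeight_node (a d : ℕ) (l r : BinaryTree Unit) :
    runWeight a d (l △ r) = runWeight (a + 1) (d + 1) l * (if r = nil then 1 else 0) +
      runWeight (a + 1) 1 l * (runWeight 0 d r - if r = nil then runWeight 0 d nil else 0) := by
  rcases r with _ | ⟨_, r, s⟩
  · simp only [runWeight, runScan_true_node, runScan_false_reverse_node_nil]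
    simp [treePath, RunScan]
  · have hr : node () r s ≠ nil := by simp
    rw [if_neg hr, if_neg hr, mul_zero, zero_add, sub_zero]
    simp only [runWeight, runScan_true_node _ _ l, runScan_false_reverse_node_node _ _ l,
      ← ite_and, mul_ite, mul_one, mul_zero]
    congr 1
    rw [eq_iff_iff]
    tauto

lemma treeGF_runWeight (a d : ℕ) :
    treeGF (runWeight a d) = C (runWeight a d nil) +
      X * (treeGF (runWeight (a + 1) (d + 1)) + treeGF (runWeight (a + 1) 1) *
        (treeGF (runWeight 0 d) - C (runWeight 0 d nil))) := by
  classical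
  rw [treeGF_of_node (runWeight_node a d), treeGF_sub, treeGF_ite_nil, treeGF_ite_nil, map_one,
    mul_one]

lemma runWeight_congr {a a' d d' : ℕ}
    (ha : ∀ k, (a + k = 0 ∨ Odd (a + k)) ↔ (a' + k = 0 ∨ Odd (a' + k)))
    (hd : ∀ k, (d + k = 0 ∨ Even (d + k)) ↔ (d' + k = 0 ∨ Even (d' + k))) :
    runWeight a d = runWeight a' d' := by
  funext t
  unfold runWeight
  congr 1
  rw [runScan_congr true Odd ha, runScan_congr false Even hd]

lemma natCard_eq_sum_runWeight (n : ℕ) :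
    (Nat.card {w : List Bool // IsDyck w ∧ w.count true = n ∧
      (∀ i l, AscRun w i l → ¬ Even l) ∧ (∀ i l, DescRun w i l → ¬ Odd l)} : ℤ) =
      ∑ t ∈ treesOfNumNodesEq n, runWeight 0 0 t := by
  classical
  have key : ∀ t : BinaryTree Unit, ((∀ i l, AscRun (treePath t) i l → ¬ Even l) ∧
      (∀ i l, DescRun (treePath t) i l → ¬ Odd l)) ↔
      RunScan true Odd 0 (treePath t) ∧ RunScan false Even 0 (treePath t).reverse := fun t => by
    simp only [Nat.not_even_iff_odd, Nat.not_odd_iff_even]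
    rw [runScan_reverse]
    exact and_congr (forall_letterRun_iff true Odd _) (forall_letterRun_iff false Even _)
  simp only [runWeight, Finset.sum_boole, ← key]
  norm_cast
  rw [← Nat.card_eq_finsetCard]
  refine (Nat.card_congr (Equiv.ofBijective (fun t => ⟨treePath t.1, isDyck_treePath t.1,
    (count_true_treePath t.1).trans (mem_treesOfNumNodesEq.1 (Finset.mem_filter.1 t.2).1),
    (Finset.mem_filter.1 t.2).2⟩)
    ⟨fun s t h => Subtype.ext (treePath_injective (Subtype.ext_iff.1 h)), ?_⟩)).symm
  · rintro ⟨w, hw, hn, hQ⟩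
    obtain ⟨t, rfl⟩ := exists_treePath_eq hw
    refine ⟨⟨t, ?_⟩, rfl⟩
    rw [Finset.mem_filter, mem_treesOfNumNodesEq, ← count_true_treePath]
    exact ⟨hn, hQ⟩

/-- If `a n` counts Dyck paths of semi-length `n` with no maximal ascending run
of even length and no maximal descending run of odd length, then
`P = ∑ a(n) xⁿ` over `ℤ` satisfies
`1 - (x² + 1) P - x² P² + x² (3x² + 2) P³ - x⁴ P⁴ - x⁴ (x² + 1) P⁵ + x⁶ P⁶ = 0`. -/
theorem statement16 (a : ℕ → ℕ)
    (ha : ∀ n, a n = Nat.card {w : List Bool // IsDyck w ∧ w.count true = n ∧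
      (∀ i l, AscRun w i l → ¬ Even l) ∧ (∀ i l, DescRun w i l → ¬ Odd l)})
    (P : PowerSeries ℤ) (hP : P = PowerSeries.mk fun n => (a n : ℤ)) :
    1 - (X ^ 2 + 1) * P - X ^ 2 * P ^ 2 + X ^ 2 * (3 * X ^ 2 + 2) * P ^ 3
      - X ^ 4 * P ^ 4 - X ^ 4 * (X ^ 2 + 1) * P ^ 5 + X ^ 6 * P ^ 6 = 0 := by
  have hP' : P = treeGF (runWeight 0 0) := by
    rw [hP, treeGF]
    congr 1
    funext n
    rw [ha, natCard_eq_sum_runWeight]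
  have h00 := treeGF_runWeight 0 0
  have h01 := treeGF_runWeight 0 1
  have h10 := treeGF_runWeight 1 0
  have h11 := treeGF_runWeight 1 1
  have h20 := treeGF_runWeight 2 0
  have h21 := treeGF_runWeight 2 1
  have e12 : runWeight 1 2 = runWeight 1 0 := runWeight_congr (by grind) (by grind)
  have e22 : runWeight 2 2 = runWeight 2 0 := runWeight_congr (by grind) (by grind)
  have e31 : runWeight 3 1 = runWeight 1 1 := runWeight_congr (by grind) (by grind)
  have e32 : runWeight 3 2 = runWeight 1 0 := runWeight_congr (by grind) (by grind)
  norm_num [runWeight_nil, Nat.odd_iff, Nat.even_iff, e12, e22, e31, e32, ← hP']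
    at h00 h01 h10 h11 h20 h21
  rw [← h01] at h21
  rw [h21] at h10 h11
  generalize treeGF (runWeight 0 1) = A at *
  generalize treeGF (runWeight 1 1) = B at *
  rw [h10] at h01
  rw [h20] at h11
  have e_lin : A * (1 - X ^ 2 * P ^ 2) = X * P := by
    linear_combination P * h01 - A * h00
  have e_quad : P - 1 = X ^ 2 * P * (P - 1) + X ^ 2 * P * A ^ 2 := by
    linear_combination h00 + X * P * h11 - X ^ 2 * P * h00
  linear_combination -(1 - X ^ 2 * P ^ 2) ^ 2 * e_quad -
    X ^ 2 * P * (A * (1 - X ^ 2 * P ^ 2) + X * P) * e_lin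
end

section
/- Let C, C1, D, D1 be sets of positive integers. For sets S, S1, T, T1 of positive integers, let h_{S,S1,T,T1}(n) denote the number of Dyck paths of semi-length n such that the length of the initial maximal ascending run is not in S1, the lengths of all other maximal ascending runs are not in S, the length of the final maximal descending run is not in T1, and the lengths of all other maximal descending runs are not in T (the empty path satisfies these conditions vacuously); let H_{S,S1,T,T1}(n) denote the same count restricted to irreducible Dyck paths. Then for every n >= 0, h_{C,C1,D,D1}(n) = [n = 0] + H_{C,C1,D,D1}(n) + \sum_{i + j + k = n, i \ge 1, k \ge 1} H_{C,C1,D,D}(i) \cdot h_{C,C,D,D}(j) \cdot H_{C,C,D,D1}(k). -/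
open Finset

/-- A Dyck path is irreducible if it is nonempty and touches the x-axis only at
its two endpoints (its height is positive strictly between the endpoints). -/
def DyckIrreducible (w : List Bool) : Prop :=
  w ≠ [] ∧ ∀ k, 0 < k → k < w.length →
    (w.take k).count false < (w.take k).count true

/-- The run restrictions: the length of the initial maximal ascending run (the
one starting at position `0`) is not in `S1`, the lengths of all other maximal
ascending runs are not in `S`, the length of the final maximal descending run
(the one ending at the end of the word) is not in `T1`, and the lengths of all
other maximal descending runs are not in `T`. -/
def RunsOK (S S1 T T1 : Set ℕ) (w : List Bool) : Prop :=
  (∀ l, AscRun w 0 l → l ∉ S1) ∧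
  (∀ i l, AscRun w (i + 1) l → l ∉ S) ∧
  (∀ i l, DescRun w i l → i + l = w.length → l ∉ T1) ∧
  (∀ i l, DescRun w i l → i + l ≠ w.length → l ∉ T)

/-- `hcount S S1 T T1 n` is the number of Dyck paths of semi-length `n`
satisfying the run restrictions `RunsOK S S1 T T1`. -/
noncomputable def hcount (S S1 T T1 : Set ℕ) (n : ℕ) : ℕ :=
  Nat.card {w : List Bool // IsDyck w ∧ w.count true = n ∧ RunsOK S S1 T T1 w}

/-- `Hcount S S1 T T1 n` is the number of irreducible Dyck paths of semi-length
`n` satisfying the run restrictions `RunsOK S S1 T T1`. -/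
noncomputable def Hcount (S S1 T T1 : Set ℕ) (n : ℕ) : ℕ :=
  Nat.card {w : List Bool // IsDyck w ∧ w.count true = n ∧ DyckIrreducible w ∧
    RunsOK S S1 T T1 w}

/-- A nonempty word with initial letter `true`, final letter `false`. -/
structure Bracketed (w : List Bool) : Prop where
  pos : 0 < w.length
  head : w[0]? = some true
  last : w[w.length - 1]? = some false

theorem getElem?_length_add_append {α : Type*} (a b : List α) (i : ℕ) :
    (a ++ b)[a.length + i]? = b[i]? := by
  rw [List.getElem?_append_right (by omega)]
  congr 1
  omega

theorem AscRun.add_le_length {w : List Bool} {i l : ℕ} (h : AscRun w i l) :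
    i + l ≤ w.length := by
  obtain ⟨h1, h2, -, -⟩ := h
  have := h2 (l - 1) (by omega)
  obtain ⟨h, -⟩ := List.getElem?_eq_some_iff.1 this
  omega

theorem DescRun.add_le_length {w : List Bool} {i l : ℕ} (h : DescRun w i l) :
    i + l ≤ w.length := by
  obtain ⟨h1, h2, -, -⟩ := h
  have := h2 (l - 1) (by omega)
  obtain ⟨h, -⟩ := List.getElem?_eq_some_iff.1 this
  omega

theorem ascRun_append_left {a b : List Bool} (ha : Bracketed a) {i l : ℕ}
    (hi : i < a.length) : AscRun (a ++ b) i l ↔ AscRun a i l := by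
  have hlast := ha.last
  have key : ∀ w : List Bool, w[a.length - 1]? = some false →
      AscRun w i l → i + l < a.length := by
    intro w hw ⟨_, h2, _, _⟩
    by_contra hlt
    have := h2 (a.length - 1 - i) (by omega)
    rw [show i + (a.length - 1 - i) = a.length - 1 by omega, hw] at this
    simp at this
  have hpos := ha.pos
  have hget : ∀ j, j < a.length → (a ++ b)[j]? = a[j]? :=
    fun j hj => List.getElem?_append_left hj
  constructor
  · intro h
    have hl := key _ (by rw [hget _ (by omega), hlast]) h
    obtain ⟨h1, h2, h3, h4⟩ := h
    refine ⟨h1, fun j hj => ?_, fun i' hi' => ?_, ?_⟩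
    · rw [← hget _ (by omega)]; exact h2 j hj
    · rw [← hget _ (by omega)]; exact h3 i' hi'
    · rwa [← hget _ hl]
  · intro h
    have hl := key _ hlast h
    obtain ⟨h1, h2, h3, h4⟩ := h
    refine ⟨h1, fun j hj => ?_, fun i' hi' => ?_, ?_⟩
    · rw [hget _ (by omega)]; exact h2 j hj
    · rw [hget _ (by omega)]; exact h3 i' hi'
    · rwa [hget _ hl]

theorem ascRun_append_right {a b : List Bool} (ha : Bracketed a) {i l : ℕ} :
    AscRun (a ++ b) (a.length + i) l ↔ AscRun b i l := by
  have hpos := ha.pos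
  unfold AscRun
  simp only [add_assoc, getElem?_length_add_append]
  refine and_congr_right fun _ => and_congr_right fun _ => and_congr_left fun _ => ?_
  constructor
  · rintro h i' rfl
    rw [← getElem?_length_add_append a]
    exact h _ (by omega)
  · intro h i' hi'
    cases i with
    | zero =>
      rw [List.getElem?_append_left (by omega), ← ha.last]
      congr 1
      omega
    | succ i =>
      rw [show i' = a.length + i by omega, getElem?_length_add_append]
      exact h i rfl

theorem descRun_append_left {a b : List Bool} (hb : Bracketed b) {i l : ℕ}
    (hi : i < a.length) : DescRun (a ++ b) i l ↔ DescRun a i l := by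
  have hmid : (a ++ b)[a.length]? = some true := by
    rw [← hb.head, ← getElem?_length_add_append a b 0, add_zero]
  have hget : ∀ j, j < a.length → (a ++ b)[j]? = a[j]? :=
    fun j hj => List.getElem?_append_left hj
  have hend : i + l ≤ a.length →
      ((a ++ b)[i + l]? ≠ some false ↔ a[i + l]? ≠ some false) := by
    intro hl
    rcases hl.lt_or_eq with h | h
    · rw [hget _ h]
    · rw [h, hmid]; simp
  constructor
  · intro h
    obtain ⟨h1, h2, h3, h4⟩ := h
    have hl : i + l ≤ a.length := by
      by_contra hlt
      have := h2 (a.length - i) (by omega)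
      rw [show i + (a.length - i) = a.length by omega, hmid] at this
      simp at this
    refine ⟨h1, fun j hj => ?_, fun i' hi' => ?_, (hend hl).1 h4⟩
    · rw [← hget _ (by omega)]; exact h2 j hj
    · rw [← hget _ (by omega)]; exact h3 i' hi'
  · intro h
    have hl := h.add_le_length
    obtain ⟨h1, h2, h3, h4⟩ := h
    refine ⟨h1, fun j hj => ?_, fun i' hi' => ?_, (hend hl).2 h4⟩
    · rw [hget _ (by omega)]; exact h2 j hj
    · rw [hget _ (by omega)]; exact h3 i' hi'

theorem Bracketed.not_descRun_zero {b : List Bool} (hb : Bracketed b) {l : ℕ} :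
    ¬ DescRun b 0 l := by
  rintro ⟨h1, h2, -, -⟩
  have := h2 0 (by omega)
  simp [hb.head] at this

theorem descRun_append_right {a b : List Bool} (hb : Bracketed b) {i l : ℕ} :
    DescRun (a ++ b) (a.length + i) l ↔ DescRun b i l := by
  cases i with
  | zero =>
    refine iff_of_false ?_ hb.not_descRun_zero
    rintro ⟨h1, h2, -, -⟩
    have := h2 0 (by omega)
    rw [add_assoc, getElem?_length_add_append] at this
    simp [hb.head] at this
  | succ i =>
    unfold DescRun
    simp only [add_assoc, getElem?_length_add_append]
    refine and_congr_right fun _ => and_congr_right fun _ => and_congr_left fun _ => ?_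
    constructor
    · intro h i' hi'
      rw [← getElem?_length_add_append a]
      exact h _ (by omega)
    · intro h i' hi'
      rw [show i' = a.length + i by omega, getElem?_length_add_append]
      exact h i rfl

theorem runsOK_append {S S1 T T1 : Set ℕ} {a b : List Bool}
    (ha : Bracketed a) (hb : Bracketed b) :
    RunsOK S S1 T T1 (a ++ b) ↔ RunsOK S S1 T T a ∧ RunsOK S S T T1 b := by
  have hpa := ha.pos
  have hpb := hb.pos
  constructor
  · rintro ⟨h1, h2, h3, h4⟩
    have hB : ∀ i l, AscRun b i l → l ∉ S := fun i l h =>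
      h2 (a.length - 1 + i) l <| by
        rw [show a.length - 1 + i + 1 = a.length + i by omega]
        exact (ascRun_append_right ha).2 h
    have hA : ∀ i l, DescRun a i l → l ∉ T := fun i l h => by
      have hl := h.add_le_length
      have h0 := h.1
      refine h4 i l ((descRun_append_left hb (by omega)).2 h) ?_
      rw [List.length_append]
      omega
    refine ⟨⟨fun l h => h1 l ((ascRun_append_left ha hpa).2 h), fun i l h => ?_,
      fun i l h _ => hA i l h, fun i l h _ => hA i l h⟩,
      fun l h => hB 0 l h, fun i l h => hB _ l h, fun i l h he => ?_, fun i l h he => ?_⟩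
    · have hl := h.add_le_length
      have h0 := h.1
      exact h2 i l ((ascRun_append_left ha (by omega)).2 h)
    · refine h3 (a.length + i) l ((descRun_append_right hb).2 h) ?_
      rw [List.length_append]
      omega
    · refine h4 (a.length + i) l ((descRun_append_right hb).2 h) ?_
      rw [List.length_append]
      omega
  · rintro ⟨⟨a1, a2, a3, a4⟩, b1, b2, b3, b4⟩
    refine ⟨fun l h => a1 l ((ascRun_append_left ha hpa).1 h), fun i l h => ?_,
      fun i l h he => ?_, fun i l h he => ?_⟩
    · rcases lt_or_ge (i + 1) a.length with hi | hi
      · exact a2 i l ((ascRun_append_left ha hi).1 h)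
      · obtain ⟨j, hj⟩ := Nat.exists_eq_add_of_le hi
        rw [hj, ascRun_append_right ha] at h
        cases j with
        | zero => exact b1 l h
        | succ j => exact b2 j l h
    · rw [List.length_append] at he
      rcases lt_or_ge i a.length with hi | hi
      · have hl := ((descRun_append_left hb hi).1 h).add_le_length
        omega
      · obtain ⟨j, rfl⟩ := Nat.exists_eq_add_of_le hi
        exact b3 j l ((descRun_append_right hb).1 h) (by omega)
    · rw [List.length_append] at he
      rcases lt_or_ge i a.length with hi | hi
      · have h' := (descRun_append_left hb hi).1 h
        by_cases hl : i + l = a.length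
        · exact a3 i l h' hl
        · exact a4 i l h' hl
      · obtain ⟨j, rfl⟩ := Nat.exists_eq_add_of_le hi
        exact b4 j l ((descRun_append_right hb).1 h) (by omega)

theorem IsDyck.nil : IsDyck [] := by simp [IsDyck]

theorem IsDyck.append {a b : List Bool} (ha : IsDyck a) (hb : IsDyck b) :
    IsDyck (a ++ b) := by
  refine ⟨by rw [List.count_append, List.count_append, ha.1, hb.1], fun k => ?_⟩
  rw [List.take_append, List.count_append, List.count_append]
  exact add_le_add (ha.2 _) (hb.2 _)

theorem IsDyck.of_append_right {a b : List Bool} (h : IsDyck (a ++ b))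
    (ha : a.count true = a.count false) : IsDyck b := by
  refine ⟨?_, fun k => ?_⟩
  · have := h.1
    rw [List.count_append, List.count_append] at this
    omega
  · have := h.2 (a.length + k)
    rw [List.take_length_add_append, List.count_append, List.count_append] at this
    omega

theorem IsDyck.of_append_left {a b : List Bool} (h : IsDyck (a ++ b))
    (ha : a.count true = a.count false) : IsDyck a := by
  refine ⟨ha, fun k => ?_⟩
  rcases le_total k a.length with hk | hk
  · have := h.2 k
    rwa [List.take_append_of_le_length hk] at this
  · rw [List.take_of_length_le hk, ha]

theorem IsDyck.bracketed {w : List Bool} (h : IsDyck w) (hw : w ≠ []) : Bracketed w := by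
  refine ⟨List.length_pos_iff.2 hw, ?_, ?_⟩
  · cases w with
    | nil => exact absurd rfl hw
    | cons c w =>
      have := h.2 1
      cases c <;> simp_all
  · obtain ⟨w', c, rfl⟩ := List.eq_nil_or_concat' w |>.resolve_left hw
    have h1 := h.1
    have h2 := h.2 w'.length
    cases c <;> simp_all
    omega

theorem DyckIrreducible.length_le_of_append_eq_left {u u' r r' : List Bool}
    (hu : IsDyck u) (hu0 : u ≠ [])
    (hi' : DyckIrreducible u') (h : u ++ r = u' ++ r') : u'.length ≤ u.length := by
  by_contra! hlt
  have h1 := hi'.2 u.length (List.length_pos_iff.2 hu0) hlt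
  have h2 : u'.take u.length = u := by
    rw [← List.take_append_of_le_length (l₂ := r') hlt.le, ← h, List.take_left]
  rw [h2, hu.1] at h1
  exact h1.false

theorem DyckIrreducible.length_le_of_append_eq_right {x x' r r' : List Bool}
    (hx : IsDyck x) (hx0 : x ≠ [])
    (hx' : IsDyck x') (hi' : DyckIrreducible x') (h : r ++ x = r' ++ x') :
    x'.length ≤ x.length := by
  by_contra! hlt
  have hxp := List.length_pos_iff.2 hx0
  have h1 := hi'.2 (x'.length - x.length) (by omega) (by omega)
  have h2 : x'.drop (x'.length - x.length) = x := by
    have hs : x <:+ x' := List.suffix_of_suffix_length_le (List.suffix_append r x)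
      (h ▸ List.suffix_append r' x') hlt.le
    exact (List.suffix_iff_eq_drop.1 hs).symm
  have ht := congrArg (List.count true) (List.take_append_drop (x'.length - x.length) x')
  have hf := congrArg (List.count false) (List.take_append_drop (x'.length - x.length) x')
  rw [List.count_append, h2] at ht hf
  have := hx.1
  have := hx'.1
  omega

theorem dyck_triple_injective {u v x u' v' x' : List Bool}
    (hu : IsDyck u) (hui : DyckIrreducible u) (hx : IsDyck x) (hxi : DyckIrreducible x)
    (hu' : IsDyck u') (hui' : DyckIrreducible u') (hx' : IsDyck x') (hxi' : DyckIrreducible x')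
    (h : u ++ (v ++ x) = u' ++ (v' ++ x')) : u = u' ∧ v = v' ∧ x = x' := by
  have hlen : u.length = u'.length :=
    le_antisymm (DyckIrreducible.length_le_of_append_eq_left hu' hui'.1 hui h.symm)
      (DyckIrreducible.length_le_of_append_eq_left hu hui.1 hui' h)
  obtain ⟨rfl, hr⟩ := List.append_inj h hlen
  have hlen : x.length = x'.length :=
    le_antisymm (DyckIrreducible.length_le_of_append_eq_right hx' hxi'.1 hx hxi hr.symm)
      (DyckIrreducible.length_le_of_append_eq_right hx hxi.1 hx' hxi' hr)
  obtain ⟨rfl, rfl⟩ := List.append_inj' hr hlen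
  exact ⟨rfl, rfl, rfl⟩

theorem IsDyck.exists_first_factor {w : List Bool} (h : IsDyck w) (hw : w ≠ []) :
    ∃ u r, w = u ++ r ∧ IsDyck u ∧ DyckIrreducible u ∧ IsDyck r := by
  classical
  have hex : ∃ k, 0 < k ∧ (w.take k).count true = (w.take k).count false :=
    ⟨w.length, List.length_pos_iff.2 hw, by rw [List.take_length]; exact h.1⟩
  obtain ⟨hk, hbal⟩ := Nat.find_spec hex
  have hmin := fun m => Nat.find_min hex (m := m)
  generalize Nat.find hex = k at hk hbal hmin
  have hd : IsDyck (w.take k ++ w.drop k) := by rwa [List.take_append_drop]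
  refine ⟨w.take k, w.drop k, (List.take_append_drop k w).symm, hd.of_append_left hbal,
    ⟨?_, fun j hj hjk => ?_⟩, hd.of_append_right hbal⟩
  · have := List.length_pos_iff.2 hw
    rw [← List.length_pos_iff, List.length_take]
    omega
  · rw [List.length_take] at hjk
    rw [List.take_take, min_eq_left (by omega)]
    have := h.2 j
    have := hmin j (by omega)
    grind

theorem IsDyck.exists_last_factor {w : List Bool} (h : IsDyck w) (hw : w ≠ []) :
    ∃ v x, w = v ++ x ∧ IsDyck v ∧ IsDyck x ∧ DyckIrreducible x := by
  induction hn : w.length using Nat.strong_induction_on generalizing w with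
  | _ n ih =>
    obtain ⟨u, r, rfl, hu, hui, hr⟩ := h.exists_first_factor hw
    rcases eq_or_ne r [] with rfl | hr0
    · exact ⟨[], u, by simp, IsDyck.nil, hu, hui⟩
    · have hpos := List.length_pos_iff.2 hui.1
      rw [List.length_append] at hn
      obtain ⟨v, x, rfl, hv, hx, hxi⟩ := ih r.length (by omega) hr hr0 rfl
      exact ⟨u ++ v, x, by simp, hu.append hv, hx, hxi⟩

theorem not_dyckIrreducible_append {a b : List Bool} (ha : IsDyck a) (ha0 : a ≠ [])
    (hb0 : b ≠ []) : ¬ DyckIrreducible (a ++ b) := by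
  rintro ⟨-, h⟩
  have := List.length_pos_iff.2 hb0
  have := h a.length (List.length_pos_iff.2 ha0) (by rw [List.length_append]; omega)
  rw [List.take_left, ha.1] at this
  exact this.false

theorem IsDyck.exists_triple {w : List Bool} (h : IsDyck w) (hw : w ≠ [])
    (hi : ¬ DyckIrreducible w) :
    ∃ u v x, w = u ++ (v ++ x) ∧ IsDyck u ∧ DyckIrreducible u ∧ IsDyck v ∧
      IsDyck x ∧ DyckIrreducible x := by
  obtain ⟨u, r, rfl, hu, hui, hr⟩ := h.exists_first_factor hw
  obtain ⟨v, x, rfl, hv, hx, hxi⟩ := hr.exists_last_factor (by rintro rfl; simp_all)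
  exact ⟨u, v, x, rfl, hu, hui, hv, hx, hxi⟩

theorem RunsOK.nil (S S1 T T1 : Set ℕ) : RunsOK S S1 T T1 [] := by
  refine ⟨fun l h => ?_, fun i l h => ?_, fun i l h => ?_, fun i l h => ?_⟩ <;>
  · have := h.1
    have := h.add_le_length
    rw [List.length_nil] at this
    omega

theorem runsOK_triple {S S1 T T1 : Set ℕ} {u v x : List Bool} (hu : IsDyck u) (hu0 : u ≠ [])
    (hv : IsDyck v) (hx : IsDyck x) (hx0 : x ≠ []) :
    RunsOK S S1 T T1 (u ++ (v ++ x)) ↔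
      RunsOK S S1 T T u ∧ RunsOK S S T T v ∧ RunsOK S S T T1 x := by
  rw [runsOK_append (hu.bracketed hu0) ((hv.append hx).bracketed (by simp [hx0]))]
  rcases eq_or_ne v [] with rfl | hv0
  · simp [RunsOK.nil]
  · rw [runsOK_append (hv.bracketed hv0) (hx.bracketed hx0)]

theorem IsDyck.count_true_eq_zero_iff {w : List Bool} (h : IsDyck w) :
    w.count true = 0 ↔ w = [] := by
  refine ⟨fun h0 => ?_, fun h0 => by simp [h0]⟩
  have := h.1
  rw [← List.length_eq_zero_iff, ← List.count_true_add_count_false w]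
  omega

theorem finite_setOf_isDyck (n : ℕ) : {w | IsDyck w ∧ w.count true = n}.Finite := by
  refine (List.finite_length_eq Bool (2 * n)).subset fun w ⟨h, hn⟩ => ?_
  have := h.1
  rw [Set.mem_ofPred_eq, ← List.count_true_add_count_false w]
  omega

open Classical in
/-- The Dyck paths of semi-length `n` satisfying the run restrictions. -/
noncomputable def dyckFinset (S S1 T T1 : Set ℕ) (n : ℕ) : Finset (List Bool) :=
  (finite_setOf_isDyck n).toFinset.filter (RunsOK S S1 T T1)

open Classical in
/-- The irreducible Dyck paths of semi-length `n` satisfying the run restrictions. -/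
noncomputable def irredFinset (S S1 T T1 : Set ℕ) (n : ℕ) : Finset (List Bool) :=
  (dyckFinset S S1 T T1 n).filter DyckIrreducible

theorem mem_dyckFinset {S S1 T T1 : Set ℕ} {n : ℕ} {w : List Bool} :
    w ∈ dyckFinset S S1 T T1 n ↔ IsDyck w ∧ w.count true = n ∧ RunsOK S S1 T T1 w := by
  simp [dyckFinset, and_assoc]

theorem mem_irredFinset {S S1 T T1 : Set ℕ} {n : ℕ} {w : List Bool} :
    w ∈ irredFinset S S1 T T1 n ↔
      IsDyck w ∧ w.count true = n ∧ DyckIrreducible w ∧ RunsOK S S1 T T1 w := by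
  simp only [irredFinset, Finset.mem_filter, mem_dyckFinset]
  tauto

theorem hcount_eq_card (S S1 T T1 : Set ℕ) (n : ℕ) :
    hcount S S1 T T1 n = (dyckFinset S S1 T T1 n).card :=
  Nat.subtype_card _ fun _ => mem_dyckFinset

theorem Hcount_eq_card (S S1 T T1 : Set ℕ) (n : ℕ) :
    Hcount S S1 T T1 n = (irredFinset S S1 T T1 n).card :=
  Nat.subtype_card _ fun _ => mem_irredFinset

open Classical in
theorem card_reducible (C C1 D D1 : Set ℕ) (n : ℕ) :
    ((dyckFinset C C1 D D1 n).filter fun w => w ≠ [] ∧ ¬ DyckIrreducible w).card =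
      ∑ i ∈ Finset.Icc 1 n, ∑ k ∈ Finset.Icc 1 (n - i),
        Hcount C C1 D D i * hcount C C D D (n - i - k) * Hcount C C D D1 k := by
  simp only [hcount_eq_card, Hcount_eq_card, ← Finset.card_product]
  simp only [← Finset.card_sigma]
  symm
  refine Finset.card_bij (fun p _ => p.2.2.1.1 ++ (p.2.2.1.2 ++ p.2.2.2)) ?_ ?_ ?_
  · rintro ⟨i, k, ⟨u, v⟩, x⟩ hp
    simp only [Finset.mem_sigma, Finset.mem_Icc, Finset.mem_product, mem_irredFinset,
      mem_dyckFinset] at hp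
    obtain ⟨hi, hk, ⟨⟨hu, hun, hui, hur⟩, hv, hvn, hvr⟩, hx, hxn, hxi, hxr⟩ := hp
    have h0 : v ++ x ≠ [] := by simp [hxi.1]
    simp only [Finset.mem_filter, mem_dyckFinset, List.count_append]
    refine ⟨⟨hu.append (hv.append hx), by omega, ?_⟩, by simp [hui.1],
      not_dyckIrreducible_append hu hui.1 h0⟩
    exact (runsOK_triple hu hui.1 hv hx hxi.1).2 ⟨hur, hvr, hxr⟩
  · rintro ⟨i, k, ⟨u, v⟩, x⟩ hp ⟨i', k', ⟨u', v'⟩, x'⟩ hp' h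
    simp only [Finset.mem_sigma, Finset.mem_product, mem_irredFinset] at hp hp'
    obtain ⟨-, -, ⟨⟨hu, rfl, hui, -⟩, -⟩, hx, rfl, hxi, -⟩ := hp
    obtain ⟨-, -, ⟨⟨hu', rfl, hui', -⟩, -⟩, hx', rfl, hxi', -⟩ := hp'
    obtain ⟨rfl, rfl, rfl⟩ := dyck_triple_injective hu hui hx hxi hu' hui' hx' hxi' h
    rfl
  · intro w hw
    simp only [Finset.mem_filter, mem_dyckFinset] at hw
    obtain ⟨⟨hw, hn, hr⟩, hw0, hwi⟩ := hw
    obtain ⟨u, v, x, rfl, hu, hui, hv, hx, hxi⟩ := hw.exists_triple hw0 hwi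
    obtain ⟨hur, hvr, hxr⟩ := (runsOK_triple hu hui.1 hv hx hxi.1).1 hr
    have hu1 := mt hu.count_true_eq_zero_iff.1 hui.1
    have hx1 := mt hx.count_true_eq_zero_iff.1 hxi.1
    rw [List.count_append, List.count_append] at hn
    refine ⟨⟨u.count true, x.count true, (u, v), x⟩, ?_, rfl⟩
    simp only [Finset.mem_sigma, Finset.mem_Icc, Finset.mem_product, mem_irredFinset,
      mem_dyckFinset]
    exact ⟨by omega, by omega, ⟨⟨hu, trivial, hui, hur⟩, hv, by omega, hvr⟩, hx, trivial, hxi, hxr⟩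

open Classical in
theorem card_filter_eq_nil (S S1 T T1 : Set ℕ) (n : ℕ) :
    ((dyckFinset S S1 T T1 n).filter (· = [])).card = if n = 0 then 1 else 0 := by
  have : (dyckFinset S S1 T T1 n).filter (· = []) = if n = 0 then {[]} else ∅ := by
    ext w
    have : [] ∈ dyckFinset S S1 T T1 n ↔ n = 0 := by
      simp [mem_dyckFinset, IsDyck.nil, RunsOK.nil, eq_comm]
    split_ifs <;> aesop
  rw [this]
  split_ifs <;> rfl

/-- For sets `C, C1, D, D1` of positive integers and all `n ≥ 0`,
`h_{C,C1,D,D1}(n) = [n = 0] + H_{C,C1,D,D1}(n)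
  + ∑_{i+j+k=n, i≥1, k≥1} H_{C,C1,D,D}(i) · h_{C,C,D,D}(j) · H_{C,C,D,D1}(k)`. -/
theorem statement17 (C C1 D D1 : Set ℕ)
    (hC : ∀ c ∈ C, 0 < c) (hC1 : ∀ c ∈ C1, 0 < c)
    (hD : ∀ d ∈ D, 0 < d) (hD1 : ∀ d ∈ D1, 0 < d) (n : ℕ) :
    hcount C C1 D D1 n =
      (if n = 0 then 1 else 0) + Hcount C C1 D D1 n +
        ∑ i ∈ Finset.Icc 1 n, ∑ k ∈ Finset.Icc 1 (n - i),
          Hcount C C1 D D i * hcount C C D D (n - i - k) * Hcount C C D D1 k := by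
  classical
  rw [← card_reducible, hcount_eq_card, Hcount_eq_card, ← card_filter_eq_nil C C1 D D1 n,
    irredFinset,
    ← Finset.card_filter_add_card_filter_not (s := dyckFinset C C1 D D1 n) (· = []),
    ← Finset.card_filter_add_card_filter_not
      (s := (dyckFinset C C1 D D1 n).filter (¬ · = [])) DyckIrreducible,
    Finset.filter_filter, Finset.filter_filter, ← add_assoc]
  congr 3
  exact Finset.filter_congr fun w _ => and_iff_right_of_imp fun h => h.1
end

section
/- Let C, C1, D, D1 be sets of positive integers with 1 not in C1 and 1 not in D1, and set C2 = {c - 1 : c in C1} and D2 = {d - 1 : d in D1}. With h and H as defined in the context, for every n >= 1, H_{C,C1,D,D1}(n) = h_{C,C2,D,D2}(n - 1). -/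
open Finset

/-- The Dyck word `U v D` obtained by elevating the word `v`. -/
def elevate (v : List Bool) : List Bool := true :: (v ++ [false])

theorem elevate_injective : Function.Injective elevate := by
  intro v v' h
  simpa [elevate] using h

theorem length_elevate (v : List Bool) : (elevate v).length = v.length + 2 := by
  simp [elevate]

theorem getElem?_elevate_zero (v : List Bool) : (elevate v)[0]? = some true := by
  simp [elevate]

theorem getElem?_elevate_succ (v : List Bool) (i : ℕ) :
    (elevate v)[i + 1]? = if i = v.length then some false else v[i]? := by
  simp only [elevate, List.getElem?_cons_succ]
  grind

theorem getElem?_elevate_succ_eq_true (v : List Bool) (i : ℕ) :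
    (elevate v)[i + 1]? = some true ↔ v[i]? = some true := by
  rw [getElem?_elevate_succ]
  grind

theorem getElem?_elevate_succ_eq_false (v : List Bool) (i : ℕ) :
    (elevate v)[i + 1]? = some false ↔ v[i]? = some false ∨ i = v.length := by
  rw [getElem?_elevate_succ]
  grind

theorem count_true_elevate (v : List Bool) : (elevate v).count true = v.count true + 1 := by
  simp [elevate]

theorem count_false_elevate (v : List Bool) : (elevate v).count false = v.count false + 1 := by
  simp [elevate]

theorem take_succ_elevate {v : List Bool} {k : ℕ} (hk : k ≤ v.length) :
    (elevate v).take (k + 1) = true :: v.take k := by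
  simp [elevate, List.take_append_of_le_length hk]

theorem IsDyck.isDyck_elevate {v : List Bool} (h : IsDyck v) : IsDyck (elevate v) := by
  refine ⟨by rw [count_true_elevate, count_false_elevate, h.1], fun k => ?_⟩
  rcases k with _ | k
  · simp
  · rcases le_or_gt k v.length with hk | hk
    · have := h.2 k
      rw [take_succ_elevate hk]
      simp
      omega
    · rw [List.take_of_length_le (by rw [length_elevate]; omega), count_true_elevate,
        count_false_elevate, h.1]

theorem IsDyck.dyckIrreducible_elevate {v : List Bool} (h : IsDyck v) :
    DyckIrreducible (elevate v) := by
  refine ⟨by simp [elevate], fun k hk hk' => ?_⟩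
  obtain ⟨k, rfl⟩ := Nat.exists_eq_succ_of_ne_zero hk.ne'
  rw [length_elevate] at hk'
  rw [Nat.succ_eq_add_one, take_succ_elevate (by omega)]
  have := h.2 k
  simp
  omega

theorem exists_elevate_eq {w : List Bool} (h : IsDyck w) (hw : DyckIrreducible w) :
    ∃ v, IsDyck v ∧ elevate v = w := by
  obtain ⟨hne, hirr⟩ := hw
  obtain ⟨heq, hpre⟩ := h
  rcases w with _ | ⟨a, w⟩
  · exact absurd rfl hne
  have ha : a = true := by
    have := hpre 1
    cases a <;> simp_all
  subst ha
  rcases List.eq_nil_or_concat' w with rfl | ⟨v, b, rfl⟩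
  · simp at heq
  have hv : ∀ k ≤ v.length, (v.take k).count false ≤ (v.take k).count true := by
    intro k hk
    have := hirr (k + 1) (by omega) (by simp; omega)
    simp [List.take_append_of_le_length hk] at this
    omega
  have hb : b = false := by
    have := hv v.length le_rfl
    cases b <;> simp_all
    omega
  subst hb
  refine ⟨v, ⟨by simpa using heq, fun k => ?_⟩, rfl⟩
  rcases le_total k v.length with hk | hk
  · exact hv k hk
  · rw [List.take_of_length_le hk]
    simpa using hv v.length le_rfl

theorem ascRun_zero_elevate {v : List Bool} {l : ℕ} (hl : 1 ≤ l) :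
    AscRun (elevate v) 0 (l + 1) ↔ AscRun v 0 l := by
  simp only [AscRun, zero_add, ne_eq, getElem?_elevate_succ_eq_true]
  refine ⟨fun ⟨_, h, _, h'⟩ => ⟨hl, fun j hj => ?_, by simp, h'⟩,
    fun ⟨_, h, _, h'⟩ => ⟨by omega, fun j hj => ?_, by simp, h'⟩⟩
  · exact (getElem?_elevate_succ_eq_true v j).1 (h (j + 1) (by omega))
  · rcases j with _ | j
    · exact getElem?_elevate_zero v
    · exact (getElem?_elevate_succ_eq_true v j).2 (h j (by omega))

theorem not_ascRun_one_elevate (v : List Bool) (l : ℕ) : ¬ AscRun (elevate v) 1 l := by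
  rintro ⟨_, _, h, _⟩
  simpa [getElem?_elevate_zero] using h 0 rfl

theorem ascRun_add_two_elevate {v : List Bool} {i l : ℕ} :
    AscRun (elevate v) (i + 2) l ↔ AscRun v (i + 1) l := by
  have e (j : ℕ) : i + 2 + j = (i + 1 + j) + 1 := by omega
  simp only [AscRun, e, ne_eq, getElem?_elevate_succ_eq_true]
  refine and_congr_right fun hl => and_congr_right fun h => and_congr_left fun _ => ?_
  have hi := h 0 hl
  have hlt : i + 1 < v.length := by grind
  have key := getElem?_elevate_succ_eq_false v i
  grind

theorem not_descRun_zero_elevate (v : List Bool) (l : ℕ) : ¬ DescRun (elevate v) 0 l := by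
  rintro ⟨hl, h, _, _⟩
  simpa [getElem?_elevate_zero] using h 0 hl

theorem descRun_pred_elevate {v : List Bool} {i : ℕ} :
    (∀ i', i + 1 = i' + 1 → (elevate v)[i']? = some true) ↔
      ∀ i', i = i' + 1 → v[i']? = some true := by
  rcases i with _ | i
  · simp [getElem?_elevate_zero]
  · simp [getElem?_elevate_succ_eq_true]

theorem descRun_elevate_of_final {v : List Bool} {i l : ℕ} (hl : 1 ≤ l)
    (hil : i + l = v.length) : DescRun (elevate v) (i + 1) (l + 1) ↔ DescRun v i l := by
  have e (j : ℕ) : i + 1 + j = (i + j) + 1 := by omega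
  unfold DescRun
  rw [descRun_pred_elevate]
  simp only [e, ne_eq, getElem?_elevate_succ_eq_false]
  constructor
  · rintro ⟨_, h, h', _⟩
    refine ⟨hl, fun j hj => ?_, h', by simp [hil]⟩
    have := h j (by omega)
    grind
  · rintro ⟨_, h, h', _⟩
    refine ⟨by omega, fun j hj => ?_, h', by grind⟩
    rcases Nat.lt_succ_iff_lt_or_eq.1 hj with hj | rfl
    · exact .inl (h j hj)
    · exact .inr hil

theorem descRun_elevate_of_not_final {v : List Bool} {i l : ℕ} :
    DescRun (elevate v) (i + 1) l ∧ i + 1 + l ≠ (elevate v).length ↔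
      DescRun v i l ∧ i + l ≠ v.length := by
  have e (j : ℕ) : i + 1 + j = (i + j) + 1 := by omega
  constructor
  · rintro ⟨h, hne⟩
    have hle := h.add_le_length
    obtain ⟨hl, h, h', hend⟩ := h
    rw [descRun_pred_elevate] at h'
    rw [length_elevate] at hne hle
    simp only [e, ne_eq, getElem?_elevate_succ_eq_false] at h hend
    refine ⟨⟨hl, fun j hj => ?_, h', fun hv => hend (.inl hv)⟩, fun hv => hend (.inr hv)⟩
    exact (h j hj).resolve_right (by omega)
  · rintro ⟨h, hne⟩
    have hle := h.add_le_length
    obtain ⟨hl, h, h', hend⟩ := h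
    refine ⟨⟨hl, fun j hj => ?_, descRun_pred_elevate.2 h', ?_⟩, ?_⟩
    · rw [e, getElem?_elevate_succ_eq_false]
      exact .inl (h j hj)
    · rw [e, ne_eq, getElem?_elevate_succ_eq_false]
      tauto
    · rw [length_elevate]
      omega

theorem mem_image_pred_iff {S : Set ℕ} {l : ℕ} (hl : 1 ≤ l) :
    l ∈ (fun c => c - 1) '' S ↔ l + 1 ∈ S := by
  refine ⟨?_, fun h => ⟨l + 1, h, rfl⟩⟩
  rintro ⟨c, hc, rfl⟩
  simp only at hl
  rwa [show c - 1 + 1 = c by omega]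

theorem runsOK_elevate {S S1 T T1 : Set ℕ} (hS1 : 1 ∉ S1) (hT1 : 1 ∉ T1) (v : List Bool) :
    RunsOK S S1 T T1 (elevate v) ↔
      RunsOK S ((fun c => c - 1) '' S1) T ((fun d => d - 1) '' T1) v := by
  refine and_congr ?_ (and_congr ?_ (and_congr ?_ ?_))
  · constructor
    · intro h l hl
      rw [mem_image_pred_iff hl.1]
      exact h _ ((ascRun_zero_elevate hl.1).2 hl)
    · intro h l hl
      obtain ⟨l, rfl⟩ := Nat.exists_eq_add_of_le' hl.1
      rcases Nat.eq_zero_or_pos l with rfl | hpos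
      · exact hS1
      · rw [← mem_image_pred_iff hpos]
        exact h _ ((ascRun_zero_elevate hpos).1 hl)
  · constructor
    · exact fun h i l hl => h (i + 1) l (ascRun_add_two_elevate.2 hl)
    · rintro h (_ | i) l hl
      · exact absurd hl (not_ascRun_one_elevate v l)
      · exact h i l (ascRun_add_two_elevate.1 hl)
  · constructor
    · intro h i l hl hil
      rw [mem_image_pred_iff hl.1]
      exact h (i + 1) _ ((descRun_elevate_of_final hl.1 hil).2 hl)
        (by rw [length_elevate]; omega)
    · rintro h (_ | i) l hl hil
      · exact absurd hl (not_descRun_zero_elevate v l)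
      obtain ⟨l, rfl⟩ := Nat.exists_eq_add_of_le' hl.1
      rw [length_elevate] at hil
      rcases Nat.eq_zero_or_pos l with rfl | hpos
      · exact hT1
      · rw [← mem_image_pred_iff hpos]
        exact h i l ((descRun_elevate_of_final hpos (by omega)).1 hl) (by omega)
  · constructor
    · intro h i l hl hil
      have := descRun_elevate_of_not_final.2 ⟨hl, hil⟩
      exact h (i + 1) l this.1 this.2
    · rintro h (_ | i) l hl hil
      · exact absurd hl (not_descRun_zero_elevate v l)
      have := descRun_elevate_of_not_final.1 ⟨hl, hil⟩
      exact h i l this.1 this.2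


/-- For sets `C, C1, D, D1` of positive integers with `1 ∉ C1` and `1 ∉ D1`,
setting `C2 = {c - 1 : c ∈ C1}` and `D2 = {d - 1 : d ∈ D1}`, we have, for every
`n ≥ 1`, `H_{C,C1,D,D1}(n) = h_{C,C2,D,D2}(n - 1)`. -/
theorem statement18 (C C1 D D1 : Set ℕ)
    (hC : ∀ c ∈ C, 0 < c) (hC1 : ∀ c ∈ C1, 0 < c)
    (hD : ∀ d ∈ D, 0 < d) (hD1 : ∀ d ∈ D1, 0 < d)
    (h1C1 : 1 ∉ C1) (h1D1 : 1 ∉ D1)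
    (C2 D2 : Set ℕ) (hC2 : C2 = (fun c => c - 1) '' C1)
    (hD2 : D2 = (fun d => d - 1) '' D1)
    (n : ℕ) (hn : 1 ≤ n) :
    Hcount C C1 D D1 n = hcount C C2 D D2 (n - 1) := by
  subst hC2 hD2
  symm
  refine Nat.card_eq_of_bijective
    (fun v => ⟨elevate v.1, v.2.1.isDyck_elevate, ?_, v.2.1.dyckIrreducible_elevate,
      (runsOK_elevate h1C1 h1D1 v.1).2 v.2.2.2⟩) ⟨fun v v' h => ?_, ?_⟩
  · rw [count_true_elevate, v.2.2.1]
    omega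
  · exact Subtype.ext (elevate_injective (congrArg Subtype.val h))
  · rintro ⟨w, hw, hcount, hirr, hruns⟩
    obtain ⟨v, hv, rfl⟩ := exists_elevate_eq hw hirr
    rw [count_true_elevate] at hcount
    exact ⟨⟨v, hv, by omega, (runsOK_elevate h1C1 h1D1 v).1 hruns⟩, rfl⟩
end
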